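/- arXiv:2507.12740 — 2 statements merged into one kernel-verified Lean document; each statement's English description precedes it below -/
import Mathlib

section
/- For every ε > 0 and k ∈ ℕ there exists C = C(ε, k) > 0 such that the following holds for every ℓ ∈ [k−1] and every sufficiently large n. Let L be an ℓ-element subset of [k] and let H be a k-partite k-graph with parts V_1, …, V_k, each of size n. If δ_L(H)·n^ℓ + δ_{[k]∖L}(H)·n^{k−ℓ} ≥ (1 + ε)·n^k, then there is a (C/n)-vertex-spread probability distribution on embeddings of perfect matchings into H (i.e., on embeddings into H of the k-graph on kn vertices consisting of n pairwise disjoint edges). -/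
open Classical in
/-- A probability distribution `μ` on functions `V → W` is `q`-vertex-spread if for any
two sequences of distinct vertices `x : Fin s → V` and `y : Fin s → W`, the probability
that `f (x i) = y i` for all `i` is at most `q ^ s`. -/
def IsVertexSpread {V W : Type*} [Fintype V] [Fintype W] [DecidableEq V] [DecidableEq W]
    (q : ℝ) (μ : (V → W) → ℝ) : Prop :=
  ∀ (s : ℕ) (x : Fin s → V) (y : Fin s → W),
    Function.Injective x → Function.Injective y →
    ∑ f ∈ Finset.univ.filter (fun f : V → W => ∀ i, f (x i) = y i), μ f ≤ q ^ s

/-- `f` is an embedding into the `k`-partite `k`-graph `H` (on parts `{i} × Fin n`) of the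
`k`-graph on `k*n` vertices consisting of `n` pairwise disjoint edges. -/
def IsPMEmbeddingKPartite {k n : ℕ} (H : Finset (Finset (Fin k × Fin n)))
    (f : (Fin k × Fin n) → (Fin k × Fin n)) : Prop :=
  Function.Injective f ∧
  ∀ j : Fin n, (Finset.univ.image fun i : Fin k => f (i, j)) ∈ H

/-- A form of Hoeffding's lemma for the uniform distribution on a finite type. -/
theorem sum_exp_le_of_abs_sub_le {ι : Type*} [Fintype ι] [Nonempty ι] (m : ι → ℝ) {r : ℝ}
    (hr : 0 < r) (h : ∀ p q, |m p - m q| ≤ r) :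
    ∑ p, Real.exp (m p) ≤
      Fintype.card ι * Real.exp ((∑ p, m p) / Fintype.card ι + r ^ 2 / 2) := by
  have hN : (0 : ℝ) < Fintype.card ι := by exact_mod_cast Fintype.card_pos
  set M : ℝ := (∑ p, m p) / Fintype.card ι with hM
  have hsum : ∑ p, (m p - M) = 0 := by
    rw [Finset.sum_sub_distrib, Finset.sum_const, Finset.card_univ, nsmul_eq_mul, hM]
    field_simp
    simp
  have hdev : ∀ p, |m p - M| ≤ r := by
    intro p
    have h1 : m p - M = (∑ q, (m p - m q)) / Fintype.card ι := by
      rw [Finset.sum_sub_distrib, Finset.sum_const, Finset.card_univ, nsmul_eq_mul, hM]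
      field_simp
    rw [h1, abs_div, abs_of_pos hN, div_le_iff₀ hN]
    calc |∑ q, (m p - m q)| ≤ ∑ q, |m p - m q| := Finset.abs_sum_le_sum_abs _ _
      _ ≤ ∑ _q : ι, r := Finset.sum_le_sum fun q _ => h p q
      _ = r * Fintype.card ι := by simp [mul_comm]
  have hpt : ∀ p, Real.exp (m p - M) ≤ Real.cosh r + (m p - M) / r * Real.sinh r := by
    intro p
    obtain ⟨h1, h2⟩ := abs_le.1 (hdev p)
    have hconv := convexOn_exp.2 (Set.mem_univ r) (Set.mem_univ (-r))
    have hc := hconv (a := (r + (m p - M)) / (2 * r)) (b := (r - (m p - M)) / (2 * r))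
      (div_nonneg (by linarith) (by linarith)) (div_nonneg (by linarith) (by linarith))
      (by field_simp; ring)
    have he : (r + (m p - M)) / (2 * r) * r + (r - (m p - M)) / (2 * r) * (-r) = m p - M := by
      field_simp; ring
    simp only [smul_eq_mul] at hc
    rw [he] at hc
    refine hc.trans (le_of_eq ?_)
    rw [Real.cosh_eq, Real.sinh_eq]
    field_simp; ring
  have htot : ∑ p, Real.exp (m p - M) ≤ Fintype.card ι * Real.exp (r ^ 2 / 2) := by
    calc ∑ p, Real.exp (m p - M)
        ≤ ∑ p, (Real.cosh r + (m p - M) / r * Real.sinh r) := Finset.sum_le_sum fun p _ => hpt p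
      _ = Fintype.card ι * Real.cosh r := by
          rw [Finset.sum_add_distrib, ← Finset.sum_mul, ← Finset.sum_div, hsum]; simp
      _ ≤ _ := by gcongr; exact Real.cosh_le_exp_half_sq r
  calc ∑ p, Real.exp (m p) = Real.exp M * ∑ p, Real.exp (m p - M) := by
        rw [Finset.mul_sum]
        refine Finset.sum_congr rfl fun p _ => ?_
        rw [← Real.exp_add]; congr 1; ring
    _ ≤ Real.exp M * (Fintype.card ι * Real.exp (r ^ 2 / 2)) := by gcongr
    _ = _ := by rw [Real.exp_add]; ring

open Equiv in
theorem decomposeFin_symm_eq_swap_mul {n : ℕ} (p : Fin (n + 1)) (e : Perm (Fin n)) :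
    Perm.decomposeFin.symm (p, e) = swap 0 p * Perm.decomposeFin.symm (0, e) := by
  ext x
  refine Fin.cases ?_ (fun y => ?_) x <;> simp

open Equiv in
theorem decomposeFin_symm_mul_swap {n : ℕ} (p : Fin (n + 1)) (e : Perm (Fin n)) (i j : Fin n) :
    Perm.decomposeFin.symm (p, e * swap i j) =
      Perm.decomposeFin.symm (p, e) * swap i.succ j.succ := by
  ext x
  refine Fin.cases ?_ (fun y => ?_) x
  · rw [Perm.mul_apply, swap_apply_of_ne_of_ne (Fin.succ_ne_zero i).symm (Fin.succ_ne_zero j).symm]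
    simp
  · rw [Perm.mul_apply, ← (Fin.succ_injective n).map_swap]
    simp

open Equiv in
/-- Exponential moments of a function on permutations that is Lipschitz for transpositions. -/
theorem sum_perm_exp_le (n : ℕ) (F : Perm (Fin n) → ℝ) {c : ℝ} (hc : 0 < c)
    (hF : ∀ π i j, |F (π * swap i j) - F π| ≤ c) :
    ∑ π, Real.exp (F π) ≤
      n.factorial * Real.exp ((∑ π, F π) / n.factorial + 2 * c ^ 2 * n) := by
  induction n with
  | zero => simp
  | succ n ih =>
    have hfac : (0 : ℝ) < n.factorial := by exact_mod_cast n.factorial_pos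
    have hsplit : ∀ G : Perm (Fin (n + 1)) → ℝ,
        ∑ π, G π = ∑ p, ∑ e, G (Perm.decomposeFin.symm (p, e)) := by
      intro G
      rw [← Perm.decomposeFin.symm.sum_comp G, Fintype.sum_prod_type]
    set m : Fin (n + 1) → ℝ :=
      fun p => (∑ e, F (Perm.decomposeFin.symm (p, e))) / n.factorial with hm
    have hinner : ∀ p, ∑ e, Real.exp (F (Perm.decomposeFin.symm (p, e))) ≤
        n.factorial * Real.exp (m p + 2 * c ^ 2 * n) := by
      intro p
      refine ih (fun e => F (Perm.decomposeFin.symm (p, e))) fun e i j => ?_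
      rw [decomposeFin_symm_mul_swap]
      exact hF _ _ _
    have hleft : ∀ π i j, |F (swap i j * π) - F π| ≤ c := by
      intro π i j
      rw [swap_mul_eq_mul_swap]
      exact hF _ _ _
    have hmdiff : ∀ p q, |m p - m q| ≤ 2 * c := by
      intro p q
      rw [hm, ← sub_div, ← Finset.sum_sub_distrib, abs_div, abs_of_pos hfac, div_le_iff₀ hfac]
      refine (Finset.abs_sum_le_sum_abs _ _).trans ?_
      have : ∀ e ∈ (Finset.univ : Finset (Perm (Fin n))),
          |F (Perm.decomposeFin.symm (p, e)) - F (Perm.decomposeFin.symm (q, e))| ≤ 2 * c := by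
        intro e _
        rw [decomposeFin_symm_eq_swap_mul p, decomposeFin_symm_eq_swap_mul q]
        have h1 := abs_le.1 (hleft (Perm.decomposeFin.symm (0, e)) 0 p)
        have h2 := abs_le.1 (hleft (Perm.decomposeFin.symm (0, e)) 0 q)
        rw [abs_le]; constructor <;> linarith
      refine (Finset.sum_le_sum this).trans (le_of_eq ?_)
      simp [Fintype.card_perm, mul_comm]
    have houter := sum_exp_le_of_abs_sub_le m (by positivity) hmdiff
    have hmean : (∑ p, m p) / (n + 1 : ℝ) = (∑ π, F π) / (n + 1).factorial := by
      rw [hsplit, hm, ← Finset.sum_div, div_div, Nat.factorial_succ]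
      push_cast; ring
    rw [Fintype.card_fin] at houter
    push_cast at houter
    rw [hmean] at houter
    rw [hsplit]
    calc ∑ p, ∑ e, Real.exp (F (Perm.decomposeFin.symm (p, e)))
        ≤ ∑ p, n.factorial * Real.exp (m p + 2 * c ^ 2 * n) :=
          Finset.sum_le_sum fun p _ => hinner p
      _ = n.factorial * Real.exp (2 * c ^ 2 * n) * ∑ p, Real.exp (m p) := by
          rw [Finset.mul_sum]
          refine Finset.sum_congr rfl fun p _ => ?_
          rw [Real.exp_add]; ring
      _ ≤ n.factorial * Real.exp (2 * c ^ 2 * n) * ((n + 1) *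
            Real.exp ((∑ π, F π) / (n + 1).factorial + (2 * c) ^ 2 / 2)) := by gcongr
      _ = _ := by
          rw [show (∑ π, F π) / ((n + 1).factorial : ℝ) + 2 * c ^ 2 * ((n + 1 : ℕ) : ℝ) =
            2 * c ^ 2 * n + ((∑ π, F π) / (n + 1).factorial + (2 * c) ^ 2 / 2) by push_cast; ring,
            Real.exp_add _ ((∑ π, F π) / ((n + 1).factorial : ℝ) + (2 * c) ^ 2 / 2),
            Nat.factorial_succ]
          push_cast; ring

open Equiv in
/-- Exponential moments of a function of several permutations that is Lipschitz for
transpositions in each coordinate. -/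
theorem sum_pi_perm_exp_le (n k : ℕ) (F : (Fin k → Perm (Fin n)) → ℝ) {c : ℝ} (hc : 0 < c)
    (hF : ∀ π l i j, |F (Function.update π l (π l * swap i j)) - F π| ≤ c) :
    ∑ π, Real.exp (F π) ≤ (n.factorial : ℝ) ^ k *
      Real.exp ((∑ π, F π) / (n.factorial : ℝ) ^ k + 2 * c ^ 2 * n * k) := by
  induction k with
  | zero => simp
  | succ k ih =>
    have hfac : (0 : ℝ) < n.factorial := by exact_mod_cast n.factorial_pos
    have hsplit : ∀ G : (Fin (k + 1) → Perm (Fin n)) → ℝ,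
        ∑ π, G π = ∑ v : Fin k → Perm (Fin n), ∑ a, G (Fin.cons a v) := by
      intro G
      rw [← (Fin.consEquiv (fun _ : Fin (k + 1) => Perm (Fin n))).sum_comp G,
        Fintype.sum_prod_type_right]
      rfl
    set g : (Fin k → Perm (Fin n)) → ℝ :=
      fun v => (∑ a, F (Fin.cons a v)) / n.factorial with hg
    have hinner : ∀ v : Fin k → Perm (Fin n), ∑ a, Real.exp (F (Fin.cons a v)) ≤
        n.factorial * Real.exp (g v + 2 * c ^ 2 * n) := by
      intro v
      refine sum_perm_exp_le n (fun a => F (Fin.cons a v)) hc fun a i j => ?_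
      have := hF (Fin.cons a v) 0 i j
      simpa [Fin.update_cons_zero] using this
    have hgL : ∀ v l i j, |g (Function.update v l (v l * swap i j)) - g v| ≤ c := by
      intro v l i j
      rw [hg, ← sub_div, ← Finset.sum_sub_distrib, abs_div, abs_of_pos hfac, div_le_iff₀ hfac]
      refine (Finset.abs_sum_le_sum_abs _ _).trans ?_
      have : ∀ a ∈ (Finset.univ : Finset (Perm (Fin n))),
          |F (Fin.cons a (Function.update v l (v l * swap i j))) - F (Fin.cons a v)| ≤ c := by
        intro a _
        have := hF (Fin.cons a v) l.succ i j
        rwa [← Fin.cons_update, Fin.cons_succ] at this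
      refine (Finset.sum_le_sum this).trans (le_of_eq ?_)
      simp [Fintype.card_perm, mul_comm]
    have houter := ih g hgL
    have hmean : (∑ v, g v) / (n.factorial : ℝ) ^ k =
        (∑ π, F π) / (n.factorial : ℝ) ^ (k + 1) := by
      rw [hsplit, hg, ← Finset.sum_div, div_div, pow_succ']
    rw [hmean] at houter
    rw [hsplit]
    calc ∑ v, ∑ a, Real.exp (F (Fin.cons a v))
        ≤ ∑ v, n.factorial * Real.exp (g v + 2 * c ^ 2 * n) :=
          Finset.sum_le_sum fun v _ => hinner v
      _ = n.factorial * Real.exp (2 * c ^ 2 * n) * ∑ v, Real.exp (g v) := by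
          rw [Finset.mul_sum]
          refine Finset.sum_congr rfl fun p _ => ?_
          rw [Real.exp_add]; ring
      _ ≤ n.factorial * Real.exp (2 * c ^ 2 * n) * ((n.factorial : ℝ) ^ k *
            Real.exp ((∑ π, F π) / (n.factorial : ℝ) ^ (k + 1) + 2 * c ^ 2 * n * k)) := by gcongr
      _ = _ := by
          rw [show (∑ π, F π) / (n.factorial : ℝ) ^ (k + 1) + 2 * c ^ 2 * n * ((k + 1 : ℕ) : ℝ) =
            2 * c ^ 2 * n + ((∑ π, F π) / (n.factorial : ℝ) ^ (k + 1) + 2 * c ^ 2 * n * k) by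
              push_cast; ring,
            Real.exp_add _ ((∑ π, F π) / (n.factorial : ℝ) ^ (k + 1) + 2 * c ^ 2 * n * k)]
          ring

open Finset in
/-- For a uniformly random choice function, prescribing the values on `U` has probability at most
`ρ ^ #U` when each single prescription has probability at most `ρ`. -/
theorem card_filter_piFinset_le {ι β : Type*} [Fintype ι] [DecidableEq ι] [DecidableEq β]
    (N A : ι → Finset β) (U : Finset ι) {ρ : ℝ}
    (h : ∀ u ∈ U, (#(N u ∩ A u) : ℝ) ≤ ρ * #(N u)) :
    (#{ω ∈ Fintype.piFinset N | ∀ u ∈ U, ω u ∈ A u} : ℝ) ≤ ρ ^ #U * #(Fintype.piFinset N) := by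
  have hsub : {ω ∈ Fintype.piFinset N | ∀ u ∈ U, ω u ∈ A u} ⊆
      Fintype.piFinset fun u => if u ∈ U then N u ∩ A u else N u := by
    intro ω hω
    simp only [mem_filter, Fintype.mem_piFinset] at hω ⊢
    intro u
    split_ifs with hu
    · exact mem_inter.2 ⟨hω.1 u, hω.2 u hu⟩
    · exact hω.1 u
  calc (#{ω ∈ Fintype.piFinset N | ∀ u ∈ U, ω u ∈ A u} : ℝ)
      ≤ #(Fintype.piFinset fun u => if u ∈ U then N u ∩ A u else N u) := by
        exact_mod_cast card_le_card hsub
    _ = ∏ u, (#(if u ∈ U then N u ∩ A u else N u) : ℝ) := by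
        rw [Fintype.card_piFinset]; push_cast; rfl
    _ ≤ ∏ u, (if u ∈ U then ρ else 1) * (#(N u) : ℝ) := by
        refine prod_le_prod (fun _ _ => by positivity) fun u _ => ?_
        split_ifs with hu
        · exact h u hu
        · simp
    _ = ρ ^ #U * #(Fintype.piFinset N) := by
        rw [prod_mul_distrib, Fintype.card_piFinset]
        push_cast
        congr 1
        simp

open Finset in
theorem card_filter_forall_sample_le {V β : Type*} [Fintype V] [DecidableEq V] [DecidableEq β]
    (D : ℕ) (N : V → Finset β) (A : Finset β) (U : Finset V) {θ τ : ℝ} (hθ : 0 ≤ θ) (hτ : 0 ≤ τ)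
    (h₁ : ∀ u ∈ U, (#(N u ∩ A) : ℝ) ≤ θ * #(N u)) (h₂ : ∀ u ∈ U, (#(N u ∩ A) : ℝ) ≤ τ * #(N u)) :
    (#{ω ∈ Fintype.piFinset fun p : V × Fin (D + 2) => N p.1 | ∀ u ∈ U, ∀ i, ω (u, i) ∈ A} : ℝ) ≤
      (θ ^ D * τ ^ 2) ^ #U * #(Fintype.piFinset fun p : V × Fin (D + 2) => N p.1) := by
  have h := card_filter_piFinset_le (fun p : V × Fin (D + 2) => N p.1) (fun _ => A)
    (U ×ˢ univ) (ρ := min θ τ) (by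
      rintro ⟨u, i⟩ hu
      have hu' : u ∈ U := by simpa using hu
      rw [min_mul_of_nonneg _ _ (by positivity)]
      exact le_min (h₁ u hu') (h₂ u hu'))
  have heq : {ω ∈ Fintype.piFinset fun p : V × Fin (D + 2) => N p.1 |
      ∀ u ∈ U, ∀ i, ω (u, i) ∈ A} = {ω ∈ Fintype.piFinset fun p : V × Fin (D + 2) => N p.1 |
      ∀ p ∈ U ×ˢ (univ : Finset (Fin (D + 2))), ω p ∈ A} := by
    refine filter_congr fun ω _ => ⟨fun h p hp => ?_, fun h u hu i => ?_⟩
    · exact h p.1 (mem_product.1 hp).1 p.2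
    · exact h (u, i) (by simpa using hu)
  rw [heq]
  refine h.trans ?_
  gcongr
  rw [card_product, card_univ, Fintype.card_fin, mul_comm, pow_mul]
  have h0 : 0 ≤ min θ τ := le_min hθ hτ
  gcongr
  rw [pow_add]
  gcongr
  · exact min_le_left _ _
  · exact min_le_right _ _

theorem pow_div_le_exp (s : ℕ) : (s : ℝ) ^ s / s.factorial ≤ Real.exp 1 ^ s := by
  rw [← Real.exp_nat_mul, mul_one]
  exact Real.pow_div_factorial_le_exp _ (by positivity) _

theorem choose_mul_div_pow_le {n s : ℕ} (hn : 0 < n) :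
    (n.choose s : ℝ) * ((s : ℝ) / n) ^ s ≤ Real.exp 1 ^ s := by
  refine le_trans ?_ (pow_div_le_exp s)
  calc (n.choose s : ℝ) * ((s : ℝ) / n) ^ s ≤ (n : ℝ) ^ s / s.factorial * ((s : ℝ) / n) ^ s := by
        gcongr; exact Nat.choose_le_pow_div s n
    _ = _ := by rw [div_pow]; field_simp

theorem choose_mul_succ_div_pow_le {n s : ℕ} (hs : s + 1 ≤ n) :
    (n.choose s : ℝ) * (((s + 1 : ℕ) : ℝ) / n) ^ (s + 1) ≤ Real.exp 1 ^ (s + 1) := by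
  refine le_trans ?_ (pow_div_le_exp (s + 1))
  have hn : (0 : ℝ) < n := by exact_mod_cast (by omega : 0 < n)
  have hsn : ((s + 1 : ℕ) : ℝ) ≤ n := by exact_mod_cast hs
  calc (n.choose s : ℝ) * (((s + 1 : ℕ) : ℝ) / n) ^ (s + 1)
      ≤ (n : ℝ) ^ s / s.factorial * (((s + 1 : ℕ) : ℝ) / n) ^ (s + 1) := by
        gcongr; exact Nat.choose_le_pow_div s n
    _ = ((s + 1 : ℕ) : ℝ) ^ (s + 1) / (s + 1).factorial * (((s + 1 : ℕ) : ℝ) / n) := by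
        rw [div_pow, Nat.factorial_succ]; push_cast; field_simp; ring
    _ ≤ ((s + 1 : ℕ) : ℝ) ^ (s + 1) / (s + 1).factorial * 1 := by
        gcongr; rwa [div_le_one hn]
    _ = _ := mul_one _

open Finset in
/-- The union bound over all potential obstructions to Hall's condition. -/
theorem sum_hall_pairs_le {n : ℕ} (hn : 0 < n) {η : ℝ} (hη : 0 ≤ η)
    (h : Real.exp 1 ^ 2 * η ≤ 1 / 5) :
    ∑ S : Finset (Fin n), ∑ _T : Finset (Fin n) with #_T + 1 = #S,
      (η * ((#S : ℝ) / n) ^ 2) ^ #S ≤ 1 / 4 := by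
  set f : ℕ → ℝ := fun s => if s = 0 then 0 else
    (n.choose (s - 1) : ℝ) * (η * ((s : ℝ) / n) ^ 2) ^ s with hf
  have h1 : ∀ S : Finset (Fin n), ∑ _T : Finset (Fin n) with #_T + 1 = #S,
      (η * ((#S : ℝ) / n) ^ 2) ^ #S = f #S := by
    intro S
    rw [sum_const, nsmul_eq_mul]
    by_cases hS : #S = 0
    · simp [hf, hS]
    · simp only [hf, hS, if_false]
      congr 2
      have : (univ.filter fun T : Finset (Fin n) => #T + 1 = #S) = powersetCard (#S - 1) univ := by
        ext T; simp only [mem_filter, mem_univ, true_and, mem_powersetCard, subset_univ]; omega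
      rw [this, card_powersetCard, card_univ, Fintype.card_fin]
  have h2 : ∑ S : Finset (Fin n), f #S = ∑ s ∈ range (n + 1), n.choose s • f s := by
    have := sum_powerset_apply_card f (x := (univ : Finset (Fin n)))
    rwa [powerset_univ, card_univ, Fintype.card_fin] at this
  rw [sum_congr rfl fun S _ => h1 S, h2, sum_range_succ']
  have h3 : ∀ s ∈ range n, n.choose (s + 1) • f (s + 1) ≤ (1 / 5) * (1 / 5 : ℝ) ^ s := by
    intro s hs
    have hs' : s + 1 ≤ n := mem_range.1 hs
    rw [nsmul_eq_mul, ← pow_succ']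
    simp only [hf, Nat.succ_ne_zero, if_false, Nat.add_sub_cancel]
    have e1 := choose_mul_div_pow_le (n := n) (s := s + 1) hn
    have e2 := choose_mul_succ_div_pow_le hs'
    calc (n.choose (s + 1) : ℝ) * ((n.choose s : ℝ) * (η * (((s + 1 : ℕ) : ℝ) / n) ^ 2) ^ (s + 1))
        = η ^ (s + 1) * (((n.choose (s + 1) : ℝ) * (((s + 1 : ℕ) : ℝ) / n) ^ (s + 1)) *
          ((n.choose s : ℝ) * (((s + 1 : ℕ) : ℝ) / n) ^ (s + 1))) := by
            rw [mul_pow, ← pow_mul, mul_comm 2, pow_mul]; ring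
      _ ≤ η ^ (s + 1) * (Real.exp 1 ^ (s + 1) * Real.exp 1 ^ (s + 1)) := by gcongr
      _ = (Real.exp 1 ^ 2 * η) ^ (s + 1) := by
            rw [mul_pow, ← pow_mul, mul_comm 2, pow_mul]; ring
      _ ≤ (1 / 5) ^ (s + 1) := by gcongr
  have h4 : ∑ s ∈ range n, (1 / 5 : ℝ) * (1 / 5 : ℝ) ^ s ≤ 1 / 4 := by
    rw [← mul_sum, geom_sum_eq (by norm_num)]
    have : (0 : ℝ) ≤ (1 / 5) ^ n := by positivity
    rw [← mul_div_assoc, div_le_iff_of_neg (by norm_num)]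
    linarith
  have h5 : n.choose 0 • f 0 = 0 := by simp [hf]
  rw [h5, add_zero]
  exact (sum_le_sum h3).trans h4

open Finset in
/-- Hall's theorem for bipartite graphs with equal parts. -/
theorem exists_perm_or_hall_obstruction {n : ℕ} (t : Fin n → Finset (Fin n)) :
    (∃ σ : Equiv.Perm (Fin n), ∀ a, σ a ∈ t a) ∨
      ∃ S T : Finset (Fin n), #T + 1 = #S ∧ ∀ a ∈ S, t a ⊆ T := by
  by_cases h : ∀ S : Finset (Fin n), #S ≤ #(S.biUnion t)
  · left
    obtain ⟨f, hf, hft⟩ := (all_card_le_biUnion_card_iff_exists_injective t).1 h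
    exact ⟨Equiv.ofBijective f (Finite.injective_iff_bijective.1 hf), hft⟩
  · right
    push Not at h
    obtain ⟨S, hS⟩ := h
    have hSn : #S ≤ n := by simpa using card_le_univ S
    obtain ⟨T, hT, hTc⟩ := exists_superset_card_eq (s := S.biUnion t) (n := #S - 1)
      (by omega) (by rw [Fintype.card_fin]; omega)
    exact ⟨S, T, by omega, fun a ha => (subset_biUnion_of_mem t ha).trans hT⟩

/-- The neighbourhoods of the vertices of a bipartite graph on `Fin n ⊕ Fin n`. -/
noncomputable def bipNbhd {n : ℕ} (B : Fin n → Fin n → Prop) : Fin n ⊕ Fin n → Finset (Fin n) := by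
  classical
  exact Sum.elim (fun a => Finset.univ.filter fun b => B a b)
    (fun b => Finset.univ.filter fun a => B a b)

/-- The ways in which every vertex can choose a sequence of `D` neighbours. -/
noncomputable def nbhdSamples {n : ℕ} (B : Fin n → Fin n → Prop) (D : ℕ) :
    Finset ((Fin n ⊕ Fin n) × Fin D → Fin n) :=
  Fintype.piFinset fun p => bipNbhd B p.1

/-- The edge `a b` is chosen by one of its endpoints. -/
def IsSampled {n D : ℕ} (ω : (Fin n ⊕ Fin n) × Fin D → Fin n) (a b : Fin n) : Prop :=
  (∃ i, ω (Sum.inl a, i) = b) ∨ ∃ i, ω (Sum.inr b, i) = a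

theorem IsSampled.rel {n D : ℕ} {B : Fin n → Fin n → Prop} {ω : (Fin n ⊕ Fin n) × Fin D → Fin n}
    (hω : ω ∈ nbhdSamples B D) {a b : Fin n} (h : IsSampled ω a b) : B a b := by
  rw [nbhdSamples, Fintype.mem_piFinset] at hω
  rcases h with ⟨i, rfl⟩ | ⟨i, rfl⟩
  · simpa [bipNbhd] using hω (Sum.inl a, i)
  · simpa [bipNbhd] using hω (Sum.inr b, i)

open Finset Classical in
theorem card_nbhdSamples_avoid_le {n D : ℕ} {ε : ℝ} (hε : 0 < ε) (hε1 : ε ≤ 1) (hn : 0 < n)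
    (B : Fin n → Fin n → Prop)
    (hB : ∀ a b, (1 + ε) * n ≤ #(bipNbhd B (Sum.inl a)) + #(bipNbhd B (Sum.inr b)))
    (S T : Finset (Fin n)) (hST : #T + 1 = #S) :
    (#{ω ∈ nbhdSamples B (D + 2) | (∀ a ∈ S, ∀ i, ω (Sum.inl a, i) ∈ T) ∧
        ∀ b ∈ Tᶜ, ∀ i, ω (Sum.inr b, i) ∈ Sᶜ} : ℝ) ≤
      (((1 - ε / 2) ^ D / ε ^ 2 * ((#S : ℝ) / n) ^ 2) ^ #S +
        ((1 - ε / 2) ^ D / ε ^ 2 * ((#Tᶜ : ℝ) / n) ^ 2) ^ #Tᶜ) * #(nbhdSamples B (D + 2)) := by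
  have hn' : (0 : ℝ) < n := by exact_mod_cast hn
  have hle : ∀ u, (#(bipNbhd B u) : ℝ) ≤ n := by
    intro u
    have := card_le_univ (bipNbhd B u)
    rw [Fintype.card_fin] at this
    exact_mod_cast this
  have hge : ∀ u, ε * n ≤ #(bipNbhd B u) := by
    rintro (a | b)
    · linarith [hB a a, hle (Sum.inr a)]
    · linarith [hB b b, hle (Sum.inl b)]
  have hθ : 0 ≤ 1 - ε / 2 := by linarith
  have hτ : ∀ (m : ℕ) (u) (A : Finset (Fin n)), #A ≤ m →
      (#(bipNbhd B u ∩ A) : ℝ) ≤ (m / (ε * n)) * #(bipNbhd B u) := by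
    intro m u A hA
    have h1 : (#(bipNbhd B u ∩ A) : ℝ) ≤ m := by
      exact_mod_cast (card_le_card inter_subset_right).trans hA
    rw [div_mul_eq_mul_div, le_div_iff₀ (by positivity)]
    have := hge u
    gcongr
  have hrw : ∀ m : ℕ, (1 - ε / 2) ^ D * ((m : ℝ) / (ε * n)) ^ 2 =
      (1 - ε / 2) ^ D / ε ^ 2 * ((m : ℝ) / n) ^ 2 := by
    intro m
    field_simp
  have hScard : #S ≤ n := by simpa using card_le_univ S
  have hTc : #Tᶜ = n - #T := by rw [card_compl, Fintype.card_fin]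
  have hSc : #Sᶜ = n - #S := by rw [card_compl, Fintype.card_fin]
  have hnn : ∀ m : ℕ, 0 ≤ ((1 - ε / 2) ^ D / ε ^ 2 * ((m : ℝ) / n) ^ 2) ^ m :=
    fun m => by positivity
  rw [add_mul]
  by_cases hcase : ∀ a, (#T : ℝ) ≤ (1 - ε / 2) * #(bipNbhd B (Sum.inl a))
  · have h := card_filter_forall_sample_le D (bipNbhd B) T (S.map ⟨_, Sum.inl_injective⟩)
      hθ (τ := #S / (ε * n)) (by positivity)
      (by
        intro u hu
        obtain ⟨a, -, rfl⟩ := mem_map.1 hu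
        refine le_trans ?_ (hcase a)
        exact_mod_cast card_le_card inter_subset_right)
      (fun u _ => hτ _ u T (by omega))
    rw [card_map, hrw] at h
    refine le_trans ?_ (le_add_of_nonneg_right (mul_nonneg (hnn _) (by positivity)))
    refine le_trans ?_ h
    refine Nat.cast_le.2 (card_le_card fun ω hω => ?_)
    rw [mem_filter] at hω ⊢
    refine ⟨hω.1, fun u hu i => ?_⟩
    obtain ⟨a, ha, rfl⟩ := mem_map.1 hu
    exact hω.2.1 a ha i
  · push Not at hcase
    obtain ⟨a, ha⟩ := hcase
    have h := card_filter_forall_sample_le D (bipNbhd B) Sᶜ (Tᶜ.map ⟨_, Sum.inr_injective⟩)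
      hθ (τ := #Tᶜ / (ε * n)) (by positivity)
      (by
        intro u hu
        obtain ⟨b, -, rfl⟩ := mem_map.1 hu
        have h1 : (#(bipNbhd B (Sum.inr b) ∩ Sᶜ) : ℝ) ≤ #Sᶜ := by
          exact_mod_cast card_le_card inter_subset_right
        have h2 : (#Sᶜ : ℝ) + #T + 1 = n := by
          exact_mod_cast (by omega : #Sᶜ + #T + 1 = n)
        have h3 := mul_le_mul_of_nonneg_left (hB a b) hθ
        have h4 : (n : ℝ) ≤ (1 - ε / 2) * ((1 + ε) * n) := by
          nlinarith [mul_nonneg (mul_nonneg hε.le hn'.le) (sub_nonneg.2 hε1)]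
        change (#(bipNbhd B (Sum.inr b) ∩ Sᶜ) : ℝ) ≤ (1 - ε / 2) * #(bipNbhd B (Sum.inr b))
        linarith)
      (fun u _ => hτ _ u Sᶜ (by omega))
    rw [card_map, hrw] at h
    refine le_trans ?_ (le_add_of_nonneg_left (mul_nonneg (hnn _) (by positivity)))
    refine le_trans ?_ h
    refine Nat.cast_le.2 (card_le_card fun ω hω => ?_)
    rw [mem_filter] at hω ⊢
    refine ⟨hω.1, fun u hu i => ?_⟩
    obtain ⟨b, hb, rfl⟩ := mem_map.1 hu
    exact hω.2.2 b hb i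

open Finset Classical in
/-- At least half of the neighbourhood samples contain a perfect matching. -/
theorem half_le_card_samples_matching {n D : ℕ} {ε : ℝ} (hε : 0 < ε) (hε1 : ε ≤ 1) (hn : 0 < n)
    (hD : Real.exp 1 ^ 2 * ((1 - ε / 2) ^ D / ε ^ 2) ≤ 1 / 5) (B : Fin n → Fin n → Prop)
    (hB : ∀ a b, (1 + ε) * n ≤ #(bipNbhd B (Sum.inl a)) + #(bipNbhd B (Sum.inr b))) :
    (#(nbhdSamples B (D + 2)) : ℝ) ≤ 2 * #{ω ∈ nbhdSamples B (D + 2) |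
      ∃ σ : Equiv.Perm (Fin n), ∀ a, IsSampled ω a (σ a)} := by
  set η : ℝ := (1 - ε / 2) ^ D / ε ^ 2 with hη
  have hη0 : 0 ≤ η := by
    have : 0 ≤ 1 - ε / 2 := by linarith
    positivity
  set P : Finset (Finset (Fin n) × Finset (Fin n)) :=
    univ.filter fun p => #p.2 + 1 = #p.1 with hP
  set φ : ℕ → ℝ := fun m => (η * ((m : ℝ) / n) ^ 2) ^ m with hφ
  have hbad : {ω ∈ nbhdSamples B (D + 2) |
      ¬ ∃ σ : Equiv.Perm (Fin n), ∀ a, IsSampled ω a (σ a)} ⊆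
      P.biUnion fun p => {ω ∈ nbhdSamples B (D + 2) | (∀ a ∈ p.1, ∀ i, ω (Sum.inl a, i) ∈ p.2) ∧
        ∀ b ∈ p.2ᶜ, ∀ i, ω (Sum.inr b, i) ∈ p.1ᶜ} := by
    intro ω hω
    rw [mem_filter] at hω
    rcases exists_perm_or_hall_obstruction
      (fun a => univ.filter fun b => IsSampled ω a b) with ⟨σ, hσ⟩ | ⟨S, T, hST, h⟩
    · exact absurd ⟨σ, fun a => by simpa using hσ a⟩ hω.2
    · refine mem_biUnion.2 ⟨(S, T), by simp [hP, hST], mem_filter.2 ⟨hω.1, ?_, ?_⟩⟩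
      · exact fun a ha i => h a ha (mem_filter.2 ⟨mem_univ _, Or.inl ⟨i, rfl⟩⟩)
      · intro b hb i
        rw [mem_compl] at hb ⊢
        exact fun hS => hb (h _ hS (mem_filter.2 ⟨mem_univ _, Or.inr ⟨i, rfl⟩⟩))
  have hsum1 : ∑ p ∈ P, φ #p.1 ≤ 1 / 4 := by
    rw [hP, sum_filter, Fintype.sum_prod_type]
    simp_rw [← sum_filter]
    exact sum_hall_pairs_le hn hη0 hD
  have hsum2 : ∑ p ∈ P, φ #p.2ᶜ = ∑ p ∈ P, φ #p.1 := by
    have hmem : ∀ p ∈ P, (p.2ᶜ, p.1ᶜ) ∈ P := by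
      intro p hp
      simp only [hP, mem_filter, mem_univ, true_and, card_compl, Fintype.card_fin] at hp ⊢
      have : #p.1 ≤ n := by simpa using card_le_univ p.1
      omega
    exact sum_nbij' (fun p => (p.2ᶜ, p.1ᶜ)) (fun p => (p.2ᶜ, p.1ᶜ)) hmem hmem
      (fun p _ => by simp) (fun p _ => by simp) (fun p _ => rfl)
  have hcount : (#{ω ∈ nbhdSamples B (D + 2) |
      ¬ ∃ σ : Equiv.Perm (Fin n), ∀ a, IsSampled ω a (σ a)} : ℝ) ≤
      1 / 2 * #(nbhdSamples B (D + 2)) := by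
    calc _ ≤ (∑ p ∈ P, #{ω ∈ nbhdSamples B (D + 2) | (∀ a ∈ p.1, ∀ i, ω (Sum.inl a, i) ∈ p.2) ∧
          ∀ b ∈ p.2ᶜ, ∀ i, ω (Sum.inr b, i) ∈ p.1ᶜ} : ℝ) := by
          exact_mod_cast (card_le_card hbad).trans card_biUnion_le
      _ ≤ ∑ p ∈ P, (φ #p.1 + φ #p.2ᶜ) * #(nbhdSamples B (D + 2)) :=
          sum_le_sum fun p hp => card_nbhdSamples_avoid_le hε hε1 hn B hB p.1 p.2
            (by simpa [hP] using hp)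
      _ = (∑ p ∈ P, φ #p.1 + ∑ p ∈ P, φ #p.2ᶜ) * #(nbhdSamples B (D + 2)) := by
          rw [← sum_mul, sum_add_distrib]
      _ ≤ 1 / 2 * #(nbhdSamples B (D + 2)) := by
          rw [hsum2]; gcongr; linarith
  have hsplit := card_filter_add_card_filter_not (s := nbhdSamples B (D + 2))
    (fun ω => ∃ σ : Equiv.Perm (Fin n), ∀ a, IsSampled ω a (σ a))
  have hsplit' := congrArg (Nat.cast : ℕ → ℝ) hsplit
  push_cast at hsplit'
  linarith

open Finset Classical in
theorem card_samples_prescribed_le {n D : ℕ} {ε : ℝ} (hε : 0 < ε) (hn : 0 < n)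
    (B : Fin n → Fin n → Prop) (hge : ∀ u, ε * n ≤ #(bipNbhd B u)) (J : Finset (Fin n))
    (b : Fin n → Fin n) (hb : Set.InjOn b J) :
    (#{ω ∈ nbhdSamples B D | ∀ j ∈ J, IsSampled ω j (b j)} : ℝ) ≤
      (2 * D / ε / n) ^ #J * #(nbhdSamples B D) := by
  have hn' : (0 : ℝ) < n := by exact_mod_cast hn
  set A : (Fin n ⊕ Fin n) × Fin D → Finset (Fin n) :=
    fun p => Sum.elim (fun a => {b a}) (fun c => J.filter fun j => b j = c) p.1 with hA
  set key : (J → Bool × Fin D) → J → (Fin n ⊕ Fin n) × Fin D :=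
    fun h j => (bif (h j).1 then Sum.inl j else Sum.inr (b j), (h j).2) with hkey
  have hkeyinj : ∀ h, Function.Injective (key h) := by
    intro h j j' hjj
    simp only [hkey, Prod.mk.injEq] at hjj
    rcases h1 : (h j).1 with _ | _ <;> rcases h2 : (h j').1 with _ | _ <;>
      simp only [h1, h2, cond_true, cond_false, Sum.inl.injEq, Sum.inr.injEq, reduceCtorEq,
        false_and] at hjj
    · exact Subtype.ext (hb j.2 j'.2 hjj.1)
    · exact Subtype.ext hjj.1
  have hAcard : ∀ u, #(A u) ≤ 1 := by
    rintro ⟨a | c, i⟩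
    · simp [hA]
    · refine card_le_one.2 fun x hx y hy => ?_
      simp only [hA, Sum.elim_inr, mem_filter] at hx hy
      exact hb hx.1 hy.1 (hx.2.trans hy.2.symm)
  have hsub : {ω ∈ nbhdSamples B D | ∀ j ∈ J, IsSampled ω j (b j)} ⊆
      (univ : Finset (J → Bool × Fin D)).biUnion fun h =>
        {ω ∈ nbhdSamples B D | ∀ u ∈ univ.image (key h), ω u ∈ A u} := by
    intro ω hω
    rw [mem_filter] at hω
    have : ∀ j : J, ∃ q : Bool × Fin D, ω (bif q.1 then Sum.inl j else Sum.inr (b j), q.2) ∈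
        A (bif q.1 then Sum.inl j else Sum.inr (b j), q.2) := by
      rintro ⟨j, hj⟩
      rcases hω.2 j hj with ⟨i, hi⟩ | ⟨i, hi⟩
      · exact ⟨(true, i), by simp [hA, hi]⟩
      · exact ⟨(false, i), by simp [hA, hi, hj]⟩
    choose h hh using this
    refine mem_biUnion.2 ⟨h, mem_univ _, mem_filter.2 ⟨hω.1, fun u hu => ?_⟩⟩
    obtain ⟨j, -, rfl⟩ := mem_image.1 hu
    exact hh j
  have hone : ∀ h, (#{ω ∈ nbhdSamples B D | ∀ u ∈ univ.image (key h), ω u ∈ A u} : ℝ) ≤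
      (1 / (ε * n)) ^ #J * #(nbhdSamples B D) := by
    intro h
    have := card_filter_piFinset_le (fun p : (Fin n ⊕ Fin n) × Fin D => bipNbhd B p.1) A
      (univ.image (key h)) (ρ := 1 / (ε * n)) (fun u _ => by
        have h1 : (#(bipNbhd B u.1 ∩ A u) : ℝ) ≤ 1 := by
          exact_mod_cast (card_le_card inter_subset_right).trans (hAcard u)
        rw [div_mul_eq_mul_div, le_div_iff₀ (by positivity)]
        have := hge u.1
        gcongr)
    rwa [card_image_of_injective _ (hkeyinj h), card_univ, Fintype.card_coe] at this
  calc (#{ω ∈ nbhdSamples B D | ∀ j ∈ J, IsSampled ω j (b j)} : ℝ)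
      ≤ ∑ h, (#{ω ∈ nbhdSamples B D | ∀ u ∈ univ.image (key h), ω u ∈ A u} : ℝ) := by
        exact_mod_cast (card_le_card hsub).trans card_biUnion_le
    _ ≤ ∑ _h : J → Bool × Fin D, (1 / (ε * n)) ^ #J * (#(nbhdSamples B D) : ℝ) :=
        sum_le_sum fun h _ => hone h
    _ = _ := by
        rw [sum_const, card_univ, Fintype.card_fun, Fintype.card_prod, Fintype.card_bool,
          Fintype.card_fin, Fintype.card_coe, nsmul_eq_mul, ← mul_assoc]
        push_cast
        rw [← mul_pow]
        congr 2
        field_simp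

open Finset Classical in
/-- A bipartite graph with parts of size `n` whose two minimum degrees sum to at least
`(1 + ε) n` admits an `O(1 / n)`-spread distribution on perfect matchings. -/
theorem exists_spread_perm {ε : ℝ} (hε : 0 < ε) (hε1 : ε ≤ 1) :
    ∃ K : ℝ, 1 ≤ K ∧ ∀ n : ℕ, 0 < n → ∀ B : Fin n → Fin n → Prop,
      (∀ a b, (1 + ε) * n ≤ (#{b' | B a b'} : ℝ) + #{a' | B a' b}) →
      ∃ ν : Equiv.Perm (Fin n) → ℝ, (∀ σ, 0 ≤ ν σ) ∧ ∑ σ, ν σ = 1 ∧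
        (∀ σ, ν σ ≠ 0 → ∀ a, B a (σ a)) ∧
        ∀ (J : Finset (Fin n)) (b : Fin n → Fin n),
          ∑ σ with ∀ j ∈ J, σ j = b j, ν σ ≤ 2 * (K / n) ^ #J := by
  have hθ1 : 1 - ε / 2 < 1 := by linarith
  obtain ⟨D, hD⟩ := exists_pow_lt_of_lt_one
    (show 0 < 1 / 5 * ε ^ 2 / Real.exp 1 ^ 2 by positivity) hθ1
  have hD' : Real.exp 1 ^ 2 * ((1 - ε / 2) ^ D / ε ^ 2) ≤ 1 / 5 := by
    rw [lt_div_iff₀ (by positivity)] at hD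
    rw [← mul_div_assoc, div_le_iff₀ (by positivity)]
    linarith
  refine ⟨2 * (D + 2 : ℕ) / ε, ?_, ?_⟩
  · rw [le_div_iff₀ hε]; push_cast
    have : (0 : ℝ) ≤ D := Nat.cast_nonneg D
    linarith
  intro n hn B hB0
  have hn' : (0 : ℝ) < n := by exact_mod_cast hn
  have hB : ∀ a b, (1 + ε) * n ≤ #(bipNbhd B (Sum.inl a)) + #(bipNbhd B (Sum.inr b)) := by
    intro a b
    have := hB0 a b
    simpa [bipNbhd] using this
  have hle : ∀ u, (#(bipNbhd B u) : ℝ) ≤ n := by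
    intro u
    have := card_le_univ (bipNbhd B u)
    rw [Fintype.card_fin] at this
    exact_mod_cast this
  have hge : ∀ u, ε * n ≤ #(bipNbhd B u) := by
    rintro (a | b)
    · linarith [hB a a, hle (Sum.inr a)]
    · linarith [hB b b, hle (Sum.inl b)]
  have hhalf := half_le_card_samples_matching hε hε1 hn hD' B hB
  set G := {ω ∈ nbhdSamples B (D + 2) |
      ∃ σ : Equiv.Perm (Fin n), ∀ a, IsSampled ω a (σ a)} with hG
  have hΩ : 0 < #(nbhdSamples B (D + 2)) := by
    rw [nbhdSamples, card_pos, Fintype.piFinset_nonempty]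
    intro p
    rw [← card_pos]
    have : (0 : ℝ) < #(bipNbhd B p.1) := lt_of_lt_of_le (by positivity) (hge p.1)
    exact_mod_cast this
  have hΩ' : (0 : ℝ) < #(nbhdSamples B (D + 2)) := by exact_mod_cast hΩ
  have hGpos : (0 : ℝ) < #G := by linarith
  have hex : ∀ ω, ∃ σ : Equiv.Perm (Fin n), ω ∈ G → ∀ a, IsSampled ω a (σ a) := by
    intro ω
    by_cases hω : ω ∈ G
    · obtain ⟨σ, hσ⟩ := (mem_filter.1 hω).2
      exact ⟨σ, fun _ => hσ⟩
    · exact ⟨1, fun h => absurd h hω⟩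
  choose Φ hΦ using hex
  have hsum : ∀ E : Finset (Equiv.Perm (Fin n)),
      ∑ σ ∈ E, (#{ω ∈ G | Φ ω = σ} : ℝ) / #G = #{ω ∈ G | Φ ω ∈ E} / #G := by
    intro E
    rw [← sum_div]
    congr 1
    have := card_eq_sum_card_fiberwise (f := Φ) (s := {ω ∈ G | Φ ω ∈ E}) (t := E)
      (fun ω hω => (mem_filter.1 hω).2)
    rw [this]
    push_cast
    refine sum_congr rfl fun σ hσ => ?_
    congr 2
    ext ω
    simp only [mem_filter]
    constructor
    · rintro ⟨h1, rfl⟩; exact ⟨⟨h1, hσ⟩, rfl⟩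
    · rintro ⟨⟨h1, -⟩, h2⟩; exact ⟨h1, h2⟩
  refine ⟨fun σ => (#{ω ∈ G | Φ ω = σ} : ℝ) / #G, fun σ => by positivity, ?_, ?_, ?_⟩
  · rw [hsum]
    simp [hGpos.ne']
  · intro σ hσ a
    have : {ω ∈ G | Φ ω = σ}.Nonempty := by
      rw [nonempty_iff_ne_empty]
      intro h
      exact hσ (by simp [h])
    obtain ⟨ω, hω⟩ := this
    obtain ⟨hω1, rfl⟩ := mem_filter.1 hω
    exact (hΦ ω hω1 a).rel (mem_filter.1 hω1).1
  · intro J b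
    rw [hsum]
    by_cases hb : Set.InjOn b J
    · have h1 := card_samples_prescribed_le (D := D + 2) hε hn B hge J b hb
      have h2 : (#{ω ∈ G | Φ ω ∈ ({σ | ∀ j ∈ J, σ j = b j} : Finset (Equiv.Perm (Fin n)))} : ℝ) ≤
          #{ω ∈ nbhdSamples B (D + 2) | ∀ j ∈ J, IsSampled ω j (b j)} := by
        refine Nat.cast_le.2 (card_le_card fun ω hω => ?_)
        simp only [mem_filter, mem_univ, true_and] at hω
        refine mem_filter.2 ⟨(mem_filter.1 hω.1).1, fun j hj => ?_⟩
        rw [← hω.2 j hj]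
        exact hΦ ω hω.1 j
      rw [div_le_iff₀ hGpos]
      calc _ ≤ _ := h2.trans h1
        _ ≤ (2 * (D + 2 : ℕ) / ε / n) ^ #J * (2 * #G) := by gcongr
        _ = _ := by ring
    · have : {ω ∈ G | Φ ω ∈ ({σ | ∀ j ∈ J, σ j = b j} : Finset (Equiv.Perm (Fin n)))} = ∅ := by
        refine filter_false_of_mem fun ω _ h => hb fun x hx y hy hxy => ?_
        have h' := (mem_filter.1 h).2
        exact (Φ ω).injective ((h' x hx).trans (hxy.trans (h' y hy).symm))
      rw [this]
      simp only [card_empty, Nat.cast_zero, zero_div]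
      positivity

theorem pow_le_exp_pow_mul_descFactorial {n s : ℕ} (hs : s ≤ n) :
    (n : ℝ) ^ s ≤ Real.exp 1 ^ s * n.descFactorial s := by
  have h1 : n ^ s * s.factorial ≤ n.descFactorial s * s ^ s := by
    rw [← Nat.descFactorial_self s, Nat.descFactorial_eq_prod_range, Nat.descFactorial_eq_prod_range,
      ← Finset.card_range s, ← Finset.prod_const, ← Finset.prod_const, Finset.card_range,
      ← Finset.prod_mul_distrib, ← Finset.prod_mul_distrib]
    refine Finset.prod_le_prod' fun i hi => ?_
    have hi' := Finset.mem_range.1 hi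
    rw [Nat.mul_sub, Nat.sub_mul]
    have := Nat.mul_le_mul_left i hs
    have h2 := Nat.mul_le_mul_left n hi'.le
    rw [mul_comm n i] at *
    omega
  have h1' : (n : ℝ) ^ s * s.factorial ≤ n.descFactorial s * (s : ℝ) ^ s := by exact_mod_cast h1
  have hf : (0 : ℝ) < s.factorial := by exact_mod_cast s.factorial_pos
  have h2 : (s : ℝ) ^ s ≤ Real.exp 1 ^ s * s.factorial := by
    rw [← div_le_iff₀ hf]; exact pow_div_le_exp s
  refine le_of_mul_le_mul_right (h1'.trans ?_) hf
  calc (n.descFactorial s : ℝ) * (s : ℝ) ^ s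
      ≤ n.descFactorial s * (Real.exp 1 ^ s * s.factorial) := by gcongr
    _ = _ := by ring

theorem exists_perm_extending {ι α : Type*} [Fintype α] (z e : ι ↪ α) :
    ∃ g : Equiv.Perm α, ∀ t, g (z t) = e t := by
  classical
  refine ⟨((Equiv.ofInjective z z.injective).symm.trans
    (Equiv.ofInjective e e.injective)).extendSubtype, fun t => ?_⟩
  rw [Equiv.extendSubtype_apply_of_mem _ _ ⟨t, rfl⟩]
  simp

open Finset in
theorem card_perm_prescribed_le {ι : Type*} [Fintype ι] {n : ℕ} (u z : ι → Fin n)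
    (hz : Function.Injective z) :
    (#{π : Equiv.Perm (Fin n) | ∀ t, π (u t) = z t} : ℝ) ≤
      (Real.exp 1 / n) ^ Fintype.card ι * n.factorial := by
  classical
  have hcard : Fintype.card ι ≤ n := by simpa using Fintype.card_le_of_injective z hz
  choose g hg using fun e : ι ↪ Fin n => exists_perm_extending ⟨z, hz⟩ e
  have hcount : #{π : Equiv.Perm (Fin n) | ∀ t, π (u t) = z t} *
      n.descFactorial (Fintype.card ι) ≤ n.factorial := by
    have h := card_le_card_of_injOn
      (s := ({π : Equiv.Perm (Fin n) | ∀ t, π (u t) = z t} : Finset (Equiv.Perm (Fin n))) ×ˢ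
        (univ : Finset (ι ↪ Fin n))) (t := univ)
      (fun p => g p.2 * p.1) (fun _ _ => mem_coe.2 (mem_univ _)) (by
        rintro ⟨π, e⟩ h ⟨π', e'⟩ h' heq
        simp only [coe_product, Set.mem_prod, mem_coe, mem_filter, mem_univ, true_and,
          and_true] at h h'
        have he : e = e' := by
          ext t
          have := congrArg (fun ρ : Equiv.Perm (Fin n) => ρ (u t)) heq
          simp only [Equiv.Perm.mul_apply, h t, h' t] at this
          have h1 := hg e t
          have h2 := hg e' t
          simp only [Function.Embedding.coeFn_mk] at h1 h2
          rw [← h1, ← h2, this]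
        subst he
        simpa using heq)
    rwa [card_product, card_univ, card_univ, Fintype.card_embedding_eq, Fintype.card_perm,
      Fintype.card_fin] at h
  rcases Nat.eq_zero_or_pos n with rfl | hn
  · have h0 : Fintype.card ι = 0 := by omega
    rw [h0] at hcount ⊢
    simp only [Nat.descFactorial_zero, mul_one] at hcount
    simpa using hcount
  have hn' : (0 : ℝ) < n := by exact_mod_cast hn
  have hd : (0 : ℝ) < n.descFactorial (Fintype.card ι) := by
    exact_mod_cast Nat.descFactorial_pos.2 hcard
  have h1 : (#{π : Equiv.Perm (Fin n) | ∀ t, π (u t) = z t} : ℝ) *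
      n.descFactorial (Fintype.card ι) ≤ n.factorial := by exact_mod_cast hcount
  have h2 := pow_le_exp_pow_mul_descFactorial hcard
  rw [div_pow, div_mul_eq_mul_div, le_div_iff₀ (by positivity)]
  calc (#{π : Equiv.Perm (Fin n) | ∀ t, π (u t) = z t} : ℝ) * (n : ℝ) ^ Fintype.card ι
      ≤ #{π : Equiv.Perm (Fin n) | ∀ t, π (u t) = z t} *
        (Real.exp 1 ^ Fintype.card ι * n.descFactorial (Fintype.card ι)) := by gcongr
    _ = Real.exp 1 ^ Fintype.card ι * (#{π : Equiv.Perm (Fin n) | ∀ t, π (u t) = z t} *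
        n.descFactorial (Fintype.card ι)) := by ring
    _ ≤ _ := by gcongr

open Finset in
theorem card_pi_perm_prescribed_le {s n k : ℕ} (w y : Fin s → Fin k × Fin n)
    (hy : Function.Injective y) :
    (#{π : Fin k → Equiv.Perm (Fin n) | ∀ t, π (y t).1 (w t).2 = (y t).2} : ℝ) ≤
      (Real.exp 1 / n) ^ s * (n.factorial : ℝ) ^ k := by
  have hset : ({π | ∀ t, π (y t).1 (w t).2 = (y t).2} : Finset (Fin k → Equiv.Perm (Fin n))) =
      Fintype.piFinset fun i => ({ρ | ∀ t : {t // (y t).1 = i}, ρ (w t).2 = (y t).2} :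
        Finset (Equiv.Perm (Fin n))) := by
    ext π
    simp only [mem_filter, mem_univ, true_and, Fintype.mem_piFinset, Subtype.forall]
    exact ⟨fun h i t ht => ht ▸ h t, fun h t => h _ t rfl⟩
  rw [hset, Fintype.card_piFinset]
  push_cast
  have hsum : ∑ i, Fintype.card {t // (y t).1 = i} = s := by
    simpa using (Fintype.card_congr (Equiv.sigmaFiberEquiv fun t => (y t).1))
  calc _ ≤ ∏ i : Fin k, (Real.exp 1 / n) ^ Fintype.card {t // (y t).1 = i} * (n.factorial : ℝ) := by
        refine prod_le_prod (fun _ _ => by positivity) fun i _ => ?_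
        refine card_perm_prescribed_le (fun t : {t // (y t).1 = i} => (w t).2)
          (fun t => (y t).2) fun t t' h => ?_
        exact Subtype.ext (hy (Prod.ext (t.2.trans t'.2.symm) h))
    _ = _ := by
        rw [prod_mul_distrib, prod_pow_eq_pow_sum, hsum, prod_const, card_univ, Fintype.card_fin]

open Finset Classical in
/-- The points `(π i b)_i` of a tuple of uniformly random permutations are uniform. -/
theorem sum_pi_perm_card_eq {n k : ℕ} [NeZero n] (P : (Fin k → Fin n) → Prop) :
    (∑ π : Fin k → Equiv.Perm (Fin n), (#{b | P fun i => π i b} : ℝ)) / (n.factorial : ℝ) ^ k =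
      n * #{y | P y} / (n : ℝ) ^ k := by
  have hn : (0 : ℝ) < n := by exact_mod_cast NeZero.pos n
  have hfac : (0 : ℝ) < n.factorial := by exact_mod_cast n.factorial_pos
  have hpt : ∀ b : Fin n, (n : ℝ) ^ k *
      ∑ π : Fin k → Equiv.Perm (Fin n), (if P fun i => π i b then (1 : ℝ) else 0) =
      (n.factorial : ℝ) ^ k * #{y | P y} := by
    intro b
    have hshift : ∀ v : Fin k → Fin n,
        ∑ π : Fin k → Equiv.Perm (Fin n), (if P fun i => π i b then (1 : ℝ) else 0) =
        ∑ π : Fin k → Equiv.Perm (Fin n), (if P ((fun i => π i b) + v) then (1 : ℝ) else 0) := by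
      intro v
      rw [← Equiv.sum_comp (Equiv.mulLeft fun i => Equiv.addRight (v i))]
      rfl
    calc (n : ℝ) ^ k *
        ∑ π : Fin k → Equiv.Perm (Fin n), (if P fun i => π i b then (1 : ℝ) else 0)
        = ∑ _v : Fin k → Fin n,
          ∑ π : Fin k → Equiv.Perm (Fin n), (if P fun i => π i b then (1 : ℝ) else 0) := by simp
      _ = ∑ v : Fin k → Fin n, ∑ π : Fin k → Equiv.Perm (Fin n),
          (if P ((fun i => π i b) + v) then (1 : ℝ) else 0) := sum_congr rfl fun v _ => hshift v
      _ = ∑ π : Fin k → Equiv.Perm (Fin n), ∑ v : Fin k → Fin n,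
          (if P ((fun i => π i b) + v) then (1 : ℝ) else 0) := sum_comm
      _ = ∑ _π : Fin k → Equiv.Perm (Fin n), ∑ v : Fin k → Fin n,
          (if P v then (1 : ℝ) else 0) :=
          sum_congr rfl fun π _ => Equiv.sum_comp (Equiv.addLeft fun i => π i b)
            fun v => if P v then (1 : ℝ) else 0
      _ = _ := by simp [Fintype.card_perm]
  rw [div_eq_div_iff (by positivity) (by positivity)]
  have : ∑ π : Fin k → Equiv.Perm (Fin n), (#{b | P fun i => π i b} : ℝ) =
      ∑ b, ∑ π : Fin k → Equiv.Perm (Fin n), (if P fun i => π i b then (1 : ℝ) else 0) := by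
    rw [sum_comm]
    simp
  rw [this, mul_comm, mul_sum, sum_congr rfl fun b _ => hpt b]
  simp
  ring

open Finset Classical in
theorem card_points_update_swap_le {n k : ℕ} (P : (Fin k → Fin n) → Prop)
    (π : Fin k → Equiv.Perm (Fin n)) (l : Fin k) (i j : Fin n) :
    #{b | P fun m => Function.update π l (π l * Equiv.swap i j) m b} ≤
      #{b | P fun m => π m b} + 2 := by
  have hsub : ({b | P fun m => Function.update π l (π l * Equiv.swap i j) m b} : Finset (Fin n)) ⊆
      ({b | P fun m => π m b} : Finset (Fin n)) ∪ {i, j} := by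
    intro b hb
    by_cases hbi : b = i
    · simp [hbi]
    by_cases hbj : b = j
    · simp [hbj]
    have : (fun m => Function.update π l (π l * Equiv.swap i j) m b) = fun m => π m b := by
      funext m
      by_cases hm : m = l
      · subst hm; simp [Equiv.swap_apply_of_ne_of_ne hbi hbj]
      · simp [hm]
    simp only [mem_filter, mem_univ, true_and, this] at hb
    simp [hb]
  exact (card_le_card hsub).trans ((card_union_le _ _).trans (by gcongr; exact card_le_two))

open Finset Classical in
/-- Lower tail for the number of points `(π i b)_i` of a tuple of random permutations that lie
in a given set. -/
theorem card_pi_perm_lower_tail_le {n k : ℕ} (hn : 0 < n) (hk : 0 < k) {η : ℝ} (hη : 0 < η)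
    (P : (Fin k → Fin n) → Prop) :
    (#{π : Fin k → Equiv.Perm (Fin n) |
        (#{b | P fun i => π i b} : ℝ) < n * #{y | P y} / (n : ℝ) ^ k - η * n} : ℝ) ≤
      Real.exp (-(η ^ 2 / (32 * k)) * n) * (n.factorial : ℝ) ^ k := by
  have : NeZero n := ⟨hn.ne'⟩
  have hk' : (0 : ℝ) < k := by exact_mod_cast hk
  set M : ℝ := n * #{y | P y} / (n : ℝ) ^ k with hM
  set l : ℝ := η / (16 * k) with hl
  have hl0 : 0 < l := by positivity
  set cnt : (Fin k → Equiv.Perm (Fin n)) → ℝ := fun π => #{b | P fun i => π i b} with hcnt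
  have hLip : ∀ π m i j, |-l * cnt (Function.update π m (π m * Equiv.swap i j)) - -l * cnt π| ≤
      2 * l := by
    intro π m i j
    have h1 := card_points_update_swap_le P π m i j
    have h2 := card_points_update_swap_le P (Function.update π m (π m * Equiv.swap i j)) m i j
    simp only [Function.update_self, Function.update_idem, mul_assoc, Equiv.swap_mul_self,
      mul_one, Function.update_eq_self] at h2
    have h1' : cnt (Function.update π m (π m * Equiv.swap i j)) ≤ cnt π + 2 := by
      simp only [hcnt]; exact_mod_cast h1
    have h2' : cnt π ≤ cnt (Function.update π m (π m * Equiv.swap i j)) + 2 := by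
      simp only [hcnt]; exact_mod_cast h2
    rw [abs_le]
    constructor <;> nlinarith
  have hmgf := sum_pi_perm_exp_le n k (fun π => -l * cnt π) (by positivity) hLip
  rw [← mul_sum, mul_div_assoc, sum_pi_perm_card_eq P, ← hM] at hmgf
  set Bad : Finset (Fin k → Equiv.Perm (Fin n)) := {π | cnt π < M - η * n} with hBad
  have hmarkov : (#Bad : ℝ) * Real.exp (-l * (M - η * n)) ≤ ∑ π, Real.exp (-l * cnt π) := by
    calc (#Bad : ℝ) * Real.exp (-l * (M - η * n)) = ∑ _π ∈ Bad, Real.exp (-l * (M - η * n)) := by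
          simp
      _ ≤ ∑ π ∈ Bad, Real.exp (-l * cnt π) := by
          refine sum_le_sum fun π hπ => Real.exp_le_exp.2 ?_
          have := (mem_filter.1 hπ).2
          nlinarith
      _ ≤ _ := sum_le_sum_of_subset_of_nonneg (subset_univ _) fun _ _ _ => (Real.exp_pos _).le
  have hexp : -l * M + 2 * (2 * l) ^ 2 * n * k =
      -(η ^ 2 / (32 * k)) * n + -l * (M - η * n) := by
    rw [hl]; field_simp; ring
  rw [hexp, Real.exp_add] at hmgf
  refine le_of_mul_le_mul_right ((hmarkov.trans hmgf).trans (le_of_eq ?_)) (Real.exp_pos _)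
  ring

open Finset Classical in
/-- For most tuples of permutations, the random bipartite graph inherits the degrees of `Q`. -/
theorem half_le_card_good_permutations {ε : ℝ} (hε : 0 < ε) {k : ℕ} (hk : 0 < k) :
    ∃ n₀ : ℕ, ∀ n : ℕ, n₀ ≤ n → ∀ Q : (Fin k → Fin n) → (Fin k → Fin n) → Prop,
      (∀ x y, (1 + ε) * (n : ℝ) ^ k ≤ (#{y' | Q x y'} : ℝ) + #{x' | Q x' y}) →
      (n.factorial : ℝ) ^ k ≤ 2 * #{π : Fin k → Equiv.Perm (Fin n) | ∀ a b : Fin n,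
        (1 + ε / 2) * n ≤ (#{b' | Q (fun i => π i a) fun i => π i b'} : ℝ) +
          #{a' | Q (fun i => π i a') fun i => π i b}} := by
  set η : ℝ := ε / 4 with hη
  have hη0 : 0 < η := by positivity
  have hk' : (0 : ℝ) < k := by exact_mod_cast hk
  have htend : Filter.Tendsto (fun n : ℕ => (n : ℝ) ^ k * Real.exp (-(η ^ 2 / (32 * k)) * n))
      Filter.atTop (nhds 0) := by
    have := (tendsto_rpow_mul_exp_neg_mul_atTop_nhds_zero k (η ^ 2 / (32 * k))
      (by positivity)).comp (tendsto_natCast_atTop_atTop (R := ℝ))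
    simpa only [Function.comp_def, Real.rpow_natCast] using this
  obtain ⟨n₀, hn₀⟩ := Filter.eventually_atTop.1
    (htend.eventually (gt_mem_nhds (show (0 : ℝ) < 1 / 4 by norm_num)))
  refine ⟨max n₀ 1, fun n hn Q hQ => ?_⟩
  have hsmall := hn₀ n ((le_max_left _ _).trans hn)
  have hn1 : 0 < n := (le_max_right n₀ 1).trans hn
  have hn' : (0 : ℝ) < n := by exact_mod_cast hn1
  set N : ℝ := (n.factorial : ℝ) ^ k with hN
  set Bad : ((Fin k → Fin n) → Prop) → Finset (Fin k → Equiv.Perm (Fin n)) := fun P =>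
    {π | (#{b | P fun i => π i b} : ℝ) < n * #{y | P y} / (n : ℝ) ^ k - η * n} with hBad
  set Good : Finset (Fin k → Equiv.Perm (Fin n)) := {π | ∀ a b : Fin n,
        (1 + ε / 2) * n ≤ (#{b' | Q (fun i => π i a) fun i => π i b'} : ℝ) +
          #{a' | Q (fun i => π i a') fun i => π i b}} with hGood
  have htail : ∀ P, (#(Bad P) : ℝ) ≤ Real.exp (-(η ^ 2 / (32 * k)) * n) * N :=
    fun P => card_pi_perm_lower_tail_le hn1 hk hη0 P
  have hcover : (univ : Finset (Fin k → Equiv.Perm (Fin n))) ⊆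
      Good ∪ ((univ.biUnion fun x => Bad (Q x)) ∪ univ.biUnion fun y => Bad fun x => Q x y) := by
    intro π _
    by_cases hπ : π ∈ (univ.biUnion fun x => Bad (Q x)) ∪ univ.biUnion fun y => Bad fun x => Q x y
    · exact mem_union_right _ hπ
    refine mem_union_left _ (mem_filter.2 ⟨mem_univ _, fun a b => ?_⟩)
    simp only [mem_union, mem_biUnion, mem_univ, true_and, hBad, mem_filter, not_or, not_exists,
      not_lt] at hπ
    have h1 := hπ.1 fun i => π i a
    have h2 := hπ.2 fun i => π i b
    have h3 := hQ (fun i => π i a) fun i => π i b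
    have h4 : (1 + ε) * n ≤ n * (#{y | Q (fun i => π i a) y} : ℝ) / (n : ℝ) ^ k +
        n * (#{x | Q x fun i => π i b} : ℝ) / (n : ℝ) ^ k := by
      rw [← add_div, ← mul_add, le_div_iff₀ (by positivity)]
      calc (1 + ε) * n * (n : ℝ) ^ k = n * ((1 + ε) * (n : ℝ) ^ k) := by ring
        _ ≤ _ := by gcongr
    have h5 : η * n + η * n = ε / 2 * n := by rw [hη]; ring
    linarith
  have hcount : N ≤ #Good + ((n : ℝ) ^ k * (Real.exp (-(η ^ 2 / (32 * k)) * n) * N) +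
      (n : ℝ) ^ k * (Real.exp (-(η ^ 2 / (32 * k)) * n) * N)) := by
    have huniv : (#(univ : Finset (Fin k → Equiv.Perm (Fin n))) : ℝ) = N := by
      simp [hN, Fintype.card_perm]
    have hunion : ∀ R : (Fin k → Fin n) → (Fin k → Fin n) → Prop,
        (#(univ.biUnion fun x => Bad (R x)) : ℝ) ≤
          (n : ℝ) ^ k * (Real.exp (-(η ^ 2 / (32 * k)) * n) * N) := by
      intro R
      calc (#(univ.biUnion fun x => Bad (R x)) : ℝ) ≤ ∑ x, (#(Bad (R x)) : ℝ) := by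
            exact_mod_cast card_biUnion_le
        _ ≤ ∑ _x : Fin k → Fin n, Real.exp (-(η ^ 2 / (32 * k)) * n) * N :=
            sum_le_sum fun x _ => htail _
        _ = _ := by simp
    rw [← huniv]
    refine (Nat.cast_le.2 ((card_le_card hcover).trans ((card_union_le _ _).trans
      (add_le_add_right (card_union_le _ _) _)))).trans ?_
    rw [huniv]
    push_cast
    exact add_le_add le_rfl (add_le_add (hunion Q) (hunion fun y x => Q x y))
  have hN0 : 0 ≤ N := by positivity
  nlinarith

open Finset Classical in
/-- The degree of a partial edge, counted through all tuples extending it. -/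
theorem degree_mul_pow_le {k n : ℕ} (H : Finset (Finset (Fin k × Fin n)))
    (hH : ∀ e ∈ H, ∀ i : Fin k, #{v ∈ e | v.1 = i} = 1) (L : Finset (Fin k)) (x : Fin k → Fin n) :
    #{e ∈ H | ∀ i ∈ L, (i, x i) ∈ e} * n ^ #L ≤
      #{y : Fin k → Fin n | (univ.image fun i => (i, if i ∈ L then x i else y i)) ∈ H} := by
  have hvert : ∀ e, ∃ z : Fin k → Fin n, e ∈ H → e = univ.image fun i => (i, z i) := by
    intro e
    by_cases he : e ∈ H
    · have : ∀ i, ∃ z, ({v ∈ e | v.1 = i}) = {(i, z)} := by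
        intro i
        obtain ⟨⟨i', z⟩, hz⟩ := card_eq_one.1 (hH e he i)
        have hmem : (i', z) ∈ {v ∈ e | v.1 = i} := by rw [hz]; exact mem_singleton_self _
        have : i' = i := (mem_filter.1 hmem).2
        exact ⟨z, by rw [hz, this]⟩
      choose z hz using this
      refine ⟨z, fun _ => ?_⟩
      ext ⟨i, w⟩
      have h1 : (i, w) ∈ e ↔ (i, w) ∈ {v ∈ e | v.1 = i} := by simp
      rw [h1, hz i]
      simp [eq_comm]
    · rcases isEmpty_or_nonempty (Fin k → Fin n) with h | ⟨⟨z⟩⟩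
      · have hk : Nonempty (Fin k) := by
          by_contra hk
          rw [not_nonempty_iff] at hk
          exact h.false fun i => hk.elim i
        have hn : IsEmpty (Fin n) := by
          by_contra hn
          rw [not_isEmpty_iff] at hn
          exact h.false fun _ => hn.some
        exact (hn.false (x hk.some)).elim
      · exact ⟨z, fun h => absurd h he⟩
  choose z hz using hvert
  have hzx : ∀ e ∈ {e ∈ H | ∀ i ∈ L, (i, x i) ∈ e}, ∀ i ∈ L, z e i = x i := by
    intro e he i hi
    obtain ⟨he, hex⟩ := mem_filter.1 he
    have h1 := hex i hi
    rw [hz e he] at h1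
    simpa using h1
  have himg : ∀ e ∈ {e ∈ H | ∀ i ∈ L, (i, x i) ∈ e}, ∀ g : L → Fin n,
      (univ.image fun i => (i, if i ∈ L then x i else
        (if h : i ∈ L then g ⟨i, h⟩ else z e i))) = e := by
    intro e he g
    conv_rhs => rw [hz e (mem_filter.1 he).1]
    congr 1
    funext i
    by_cases hi : i ∈ L
    · simp [hi, hzx e he i hi]
    · simp [hi]
  have h := card_le_card_of_injOn
    (s := {e ∈ H | ∀ i ∈ L, (i, x i) ∈ e} ×ˢ (univ : Finset (L → Fin n)))
    (t := {y : Fin k → Fin n | (univ.image fun i => (i, if i ∈ L then x i else y i)) ∈ H})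
    (fun p i => if h : i ∈ L then p.2 ⟨i, h⟩ else z p.1 i)
    (by
      rintro ⟨e, g⟩ hp
      have he := (mem_product.1 (mem_coe.1 hp)).1
      simp only [coe_filter, Set.mem_ofPred_eq, mem_univ, true_and]
      rw [himg e he g]
      exact (mem_filter.1 he).1)
    (by
      rintro ⟨e, g⟩ hp ⟨e', g'⟩ hp' heq
      have he := (mem_product.1 (mem_coe.1 hp)).1
      have he' := (mem_product.1 (mem_coe.1 hp')).1
      have hee : e = e' := by
        rw [← himg e he g, ← himg e' he' g']
        congr 1
        funext i
        have := congrFun heq i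
        simp only at this
        rw [this]
      refine Prod.ext hee (funext fun i => ?_)
      have := congrFun heq i
      simpa using this)
  simpa [card_product] using h

/-- The embedding of a perfect matching that joins the `j`-th transversal of the parts in `L` to
the `σ j`-th transversal of the remaining parts. -/
def glueEmb {k n : ℕ} (L : Finset (Fin k)) (π : Fin k → Equiv.Perm (Fin n))
    (σ : Equiv.Perm (Fin n)) (p : Fin k × Fin n) : Fin k × Fin n :=
  (p.1, π p.1 (if p.1 ∈ L then p.2 else σ p.2))

theorem glueEmb_injective {k n : ℕ} (L : Finset (Fin k)) (π : Fin k → Equiv.Perm (Fin n))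
    (σ : Equiv.Perm (Fin n)) : Function.Injective (glueEmb L π σ) := by
  rintro ⟨i, j⟩ ⟨i', j'⟩ h
  simp only [glueEmb, Prod.mk.injEq] at h
  obtain ⟨rfl, h⟩ := h
  have h := (π i).injective h
  split_ifs at h with hi
  · rw [h]
  · rw [σ.injective h]

open Finset in
theorem sum_biUnion_le_of_nonneg {ι α : Type*} [DecidableEq α] (s : Finset ι) (t : ι → Finset α)
    {f : α → ℝ} (hf : ∀ a, 0 ≤ f a) : ∑ a ∈ s.biUnion t, f a ≤ ∑ i ∈ s, ∑ a ∈ t i, f a := by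
  classical
  induction s using Finset.induction_on with
  | empty => simp
  | insert i s hi ih =>
    rw [biUnion_insert, sum_insert hi]
    have h := sum_union_inter (s₁ := t i) (s₂ := s.biUnion t) (f := f)
    have h' : 0 ≤ ∑ a ∈ t i ∩ s.biUnion t, f a := sum_nonneg fun a _ => hf a
    linarith

open Finset Classical in
/-- The spread estimate: permutations `π` chosen uniformly from `G` combined with an
`O(1 / n)`-spread random permutation depending on `π`. -/
theorem sum_glueEmb_prescribed_le {k n s : ℕ} (hn : 0 < n) (L : Finset (Fin k)) {K : ℝ}
    (hK : 1 ≤ K) (G : Finset (Fin k → Equiv.Perm (Fin n)))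
    (ν : (Fin k → Equiv.Perm (Fin n)) → Equiv.Perm (Fin n) → ℝ) (hν0 : ∀ π ∈ G, ∀ σ, 0 ≤ ν π σ)
    (hν : ∀ π ∈ G, ∀ (J : Finset (Fin n)) (b : Fin n → Fin n),
      ∑ σ with ∀ j ∈ J, σ j = b j, ν π σ ≤ 2 * (K / n) ^ #J)
    (x y : Fin s → Fin k × Fin n) (hy : Function.Injective y) :
    ∑ π ∈ G, ∑ σ with ∀ t, glueEmb L π σ (x t) = y t, ν π σ ≤
      2 * (Real.exp 1 * K / n) ^ s * (n.factorial : ℝ) ^ k := by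
  have hn' : (0 : ℝ) < n := by exact_mod_cast hn
  have hK0 : 0 < K := by linarith
  by_cases hxy : ∀ t, (x t).1 = (y t).1
  swap
  · obtain ⟨t, ht⟩ := not_forall.1 hxy
    rw [sum_eq_zero]
    · positivity
    intro π _
    rw [filter_false_of_mem, sum_empty]
    intro σ _ h
    have h1 : (glueEmb L π σ (x t)).1 = (y t).1 := congrArg Prod.fst (h t)
    exact ht h1
  set J : Finset (Fin n) := ({t | (x t).1 ∉ L} : Finset (Fin s)).image fun t => (x t).2 with hJ
  have hJs : #J ≤ s := card_image_le.trans (by simpa using card_le_univ (α := Fin s) _)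
  set val : (J → Fin n) → Fin n → Fin n := fun b j => if h : j ∈ J then b ⟨j, h⟩ else j with hval
  set w : (J → Fin n) → Fin s → Fin k × Fin n :=
    fun b t => ((x t).1, if (x t).1 ∈ L then (x t).2 else val b (x t).2) with hw
  have hKn : 0 ≤ 2 * (K / n) ^ #J := by positivity
  have hpt : ∀ π ∈ G, ∑ σ with ∀ t, glueEmb L π σ (x t) = y t, ν π σ ≤
      ∑ b : J → Fin n, if ∀ t, π (y t).1 (w b t).2 = (y t).2 then 2 * (K / n) ^ #J else 0 := by
    intro π hπ
    have hsub : ({σ | ∀ t, glueEmb L π σ (x t) = y t} : Finset (Equiv.Perm (Fin n))) ⊆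
        (univ.filter fun b : J → Fin n => ∀ t, π (y t).1 (w b t).2 = (y t).2).biUnion
          fun b => {σ | ∀ j ∈ J, σ j = val b j} := by
      intro σ hσ
      have hσ' := (mem_filter.1 hσ).2
      have hb : ∀ j ∈ J, σ j = val (fun j => σ j) j := by
        intro j hj
        simp [hval, hj]
      refine mem_biUnion.2 ⟨fun j => σ j, mem_filter.2 ⟨mem_univ _, fun t => ?_⟩,
        mem_filter.2 ⟨mem_univ _, hb⟩⟩
      rw [← hσ' t]
      simp only [glueEmb, hw]
      by_cases ht : (x t).1 ∈ L
      · simp [ht]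
      · have hmem : (x t).2 ∈ J := mem_image.2 ⟨t, by simp [ht], rfl⟩
        simp only [ht, if_false]
        rw [hb _ hmem]
    rw [← sum_filter]
    calc ∑ σ with ∀ t, glueEmb L π σ (x t) = y t, ν π σ
        ≤ ∑ σ ∈ (univ.filter fun b : J → Fin n =>
            ∀ t, π (y t).1 (w b t).2 = (y t).2).biUnion
            fun b => {σ | ∀ j ∈ J, σ j = val b j}, ν π σ :=
          sum_le_sum_of_subset_of_nonneg hsub fun σ _ _ => hν0 π hπ σ
      _ ≤ ∑ b with ∀ t, π (y t).1 (w b t).2 = (y t).2,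
            ∑ σ with ∀ j ∈ J, σ j = val b j, ν π σ :=
          sum_biUnion_le_of_nonneg _ _ fun σ => hν0 π hπ σ
      _ ≤ _ := sum_le_sum fun b _ => hν π hπ J (val b)
  calc ∑ π ∈ G, ∑ σ with ∀ t, glueEmb L π σ (x t) = y t, ν π σ
      ≤ ∑ π ∈ G, ∑ b : J → Fin n,
          (if ∀ t, π (y t).1 (w b t).2 = (y t).2 then 2 * (K / n) ^ #J else 0) :=
        sum_le_sum hpt
    _ ≤ ∑ π : Fin k → Equiv.Perm (Fin n), ∑ b : J → Fin n,
          (if ∀ t, π (y t).1 (w b t).2 = (y t).2 then 2 * (K / n) ^ #J else 0) :=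
        sum_le_univ_sum_of_nonneg fun π => sum_nonneg fun b _ => ite_nonneg hKn le_rfl
    _ = ∑ b : J → Fin n, (#{π : Fin k → Equiv.Perm (Fin n) |
          ∀ t, π (y t).1 (w b t).2 = (y t).2} : ℝ) * (2 * (K / n) ^ #J) := by
        rw [sum_comm]
        refine sum_congr rfl fun b _ => ?_
        rw [← sum_filter, sum_const, nsmul_eq_mul]
    _ ≤ ∑ _b : J → Fin n, ((Real.exp 1 / n) ^ s * (n.factorial : ℝ) ^ k) *
          (2 * (K / n) ^ #J) := by
        refine sum_le_sum fun b _ => ?_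
        gcongr
        exact card_pi_perm_prescribed_le (w b) y hy
    _ = 2 * ((Real.exp 1 / n) ^ s * K ^ #J) * (n.factorial : ℝ) ^ k := by
        rw [sum_const, card_univ, Fintype.card_fun, Fintype.card_coe, Fintype.card_fin,
          nsmul_eq_mul, Nat.cast_pow, div_pow K]
        have hnJ : (n : ℝ) ^ #J ≠ 0 := pow_ne_zero _ hn'.ne'
        generalize (Real.exp 1 / n) ^ s = A, (n.factorial : ℝ) ^ k = N
        field_simp
    _ ≤ 2 * ((Real.exp 1 / n) ^ s * K ^ s) * (n.factorial : ℝ) ^ k := by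
        have hKJ : K ^ #J ≤ K ^ s := pow_le_pow_right₀ hK hJs
        gcongr
    _ = 2 * (Real.exp 1 * K / n) ^ s * (n.factorial : ℝ) ^ k := by
        rw [← mul_pow, div_mul_eq_mul_div]

theorem vertex_spread_PM_kpartite (ε : ℝ) (hε : 0 < ε) (k : ℕ) (hk : 2 ≤ k) :
    ∃ C : ℝ, 0 < C ∧
    ∀ L : Finset (Fin k), 1 ≤ L.card → L.card ≤ k - 1 →
    ∃ n₀ : ℕ, ∀ n : ℕ, n₀ ≤ n →
    ∀ H : Finset (Finset (Fin k × Fin n)),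
      (∀ e ∈ H, ∀ i : Fin k, (e.filter fun v => v.1 = i).card = 1) →
      (∀ x y : Fin k → Fin n,
        ((H.filter fun e => ∀ i ∈ L, (i, x i) ∈ e).card : ℝ) * (n : ℝ) ^ L.card +
          ((H.filter fun e => ∀ i ∈ Lᶜ, (i, y i) ∈ e).card : ℝ) * (n : ℝ) ^ (k - L.card) ≥
          (1 + ε) * (n : ℝ) ^ k) →
      ∃ μ : ((Fin k × Fin n) → (Fin k × Fin n)) → ℝ,
        (∀ f, 0 ≤ μ f) ∧ (∑ f, μ f = 1) ∧
        (∀ f, μ f ≠ 0 → IsPMEmbeddingKPartite H f) ∧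
        IsVertexSpread (C / n) μ := by
  classical
  have hδ0 : 0 < min ε 1 / 2 := by positivity
  have hδ1 : min ε 1 / 2 ≤ 1 := by linarith [min_le_right ε 1]
  obtain ⟨K, hK, hspread⟩ := exists_spread_perm hδ0 hδ1
  have hK0 : 0 < K := by linarith
  refine ⟨4 * (Real.exp 1 * K), by positivity, fun L _ _ => ?_⟩
  obtain ⟨n₀, hn₀⟩ := half_le_card_good_permutations (ε := min ε 1) (by positivity)
    (show 0 < k by omega)
  refine ⟨max n₀ 1, fun n hn H hH hdeg => ?_⟩
  have hn1 : 0 < n := (le_max_right n₀ 1).trans hn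
  have hn' : (0 : ℝ) < n := by exact_mod_cast hn1
  set Q : (Fin k → Fin n) → (Fin k → Fin n) → Prop := fun x y =>
    (Finset.univ.image fun i => (i, if i ∈ L then x i else y i)) ∈ H with hQ
  have hQdeg : ∀ x y, (1 + min ε 1) * (n : ℝ) ^ k ≤
      ((Finset.univ.filter fun y' => Q x y').card : ℝ) +
        (Finset.univ.filter fun x' => Q x' y).card := by
    intro x y
    have h1 := degree_mul_pow_le H hH L x
    have h2 := degree_mul_pow_le H hH Lᶜ y
    have h3 := hdeg x y
    rw [Finset.card_compl, Fintype.card_fin] at h2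
    have h1' : ((H.filter fun e => ∀ i ∈ L, (i, x i) ∈ e).card : ℝ) * (n : ℝ) ^ L.card ≤
        (Finset.univ.filter fun y' => Q x y').card := by
      refine le_trans (le_of_eq ?_) (Nat.cast_le.2 (h1.trans (le_of_eq ?_)))
      · push_cast; congr
      · congr
    have h2' : ((H.filter fun e => ∀ i ∈ Lᶜ, (i, y i) ∈ e).card : ℝ) * (n : ℝ) ^ (k - L.card) ≤
        (Finset.univ.filter fun x' => Q x' y).card := by
      refine le_trans (le_of_eq ?_) (Nat.cast_le.2 (h2.trans (le_of_eq ?_)))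
      · push_cast; congr
      · congr 1
        ext z
        simp only [Finset.mem_filter, Finset.mem_univ, true_and, hQ, Finset.mem_compl, ite_not]
    have h4 : (1 + min ε 1) * (n : ℝ) ^ k ≤ (1 + ε) * (n : ℝ) ^ k := by
      gcongr; exact min_le_left _ _
    linarith
  set G : Finset (Fin k → Equiv.Perm (Fin n)) := Finset.univ.filter fun π => ∀ a b : Fin n,
    (1 + min ε 1 / 2) * n ≤
      ((Finset.univ.filter fun b' => Q (fun i => π i a) fun i => π i b').card : ℝ) +
      (Finset.univ.filter fun a' => Q (fun i => π i a') fun i => π i b).card with hG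
  have hN : (0 : ℝ) < (n.factorial : ℝ) ^ k :=
    pow_pos (by exact_mod_cast n.factorial_pos) _
  have hhalf : (n.factorial : ℝ) ^ k ≤ 2 * G.card := by
    convert hn₀ n ((le_max_left _ _).trans hn) Q fun x y => by convert hQdeg x y
  have hGpos : (0 : ℝ) < G.card := by linarith
  have hν : ∀ π, ∃ ν : Equiv.Perm (Fin n) → ℝ, π ∈ G → ((∀ σ, 0 ≤ ν σ) ∧ ∑ σ, ν σ = 1 ∧
      (∀ σ, ν σ ≠ 0 → ∀ a, Q (fun i => π i a) fun i => π i (σ a)) ∧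
        ∀ (J : Finset (Fin n)) (b : Fin n → Fin n),
          ∑ σ with ∀ j ∈ J, σ j = b j, ν σ ≤ 2 * (K / n) ^ J.card) := by
    intro π
    by_cases hπ : π ∈ G
    · obtain ⟨ν, h1, h2, h3, h4⟩ := hspread n hn1
        (fun a b => Q (fun i => π i a) fun i => π i b)
        (by convert (Finset.mem_filter.1 hπ).2)
      exact ⟨ν, fun _ => ⟨h1, h2, h3, fun J b => by convert h4 J b⟩⟩
    · exact ⟨0, fun h => absurd h hπ⟩
  choose ν hν using hν
  set μ : ((Fin k × Fin n) → (Fin k × Fin n)) → ℝ := fun f =>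
    (∑ π ∈ G, ∑ σ, if glueEmb L π σ = f then ν π σ else 0) / G.card with hμ
  have hμsum : ∀ E : Finset ((Fin k × Fin n) → (Fin k × Fin n)),
      ∑ f ∈ E, μ f = (∑ π ∈ G, ∑ σ with glueEmb L π σ ∈ E, ν π σ) / G.card := by
    intro E
    rw [hμ, ← Finset.sum_div, Finset.sum_comm]
    congr 1
    refine Finset.sum_congr rfl fun π _ => ?_
    rw [Finset.sum_comm, Finset.sum_filter]
    refine Finset.sum_congr rfl fun σ _ => ?_
    rw [Finset.sum_ite_eq]
  have hμ0 : ∀ f, 0 ≤ μ f := by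
    intro f
    refine div_nonneg (Finset.sum_nonneg fun π hπ => Finset.sum_nonneg fun σ _ => ?_) hGpos.le
    split_ifs
    · exact (hν π hπ).1 σ
    · exact le_rfl
  have hμ1 : ∑ f, μ f = 1 := by
    rw [hμsum]
    simp only [Finset.mem_univ, Finset.filter_true]
    rw [Finset.sum_congr rfl fun π hπ => (hν π hπ).2.1]
    simp [hGpos.ne']
  refine ⟨μ, hμ0, hμ1, fun f hf => ?_, ?_⟩
  · have hne : ∑ π ∈ G, ∑ σ, (if glueEmb L π σ = f then ν π σ else 0) ≠ 0 :=
      fun h => hf (by simp [hμ, h])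
    obtain ⟨π, hπ, hne⟩ := Finset.exists_ne_zero_of_sum_ne_zero hne
    obtain ⟨σ, -, hne⟩ := Finset.exists_ne_zero_of_sum_ne_zero hne
    obtain ⟨rfl, hne'⟩ := ite_ne_right_iff.1 hne
    refine ⟨glueEmb_injective L π σ, fun j => ?_⟩
    have h := (hν π hπ).2.2.1 σ hne' j
    simp only [hQ] at h
    convert h using 3 with i
    simp only [glueEmb, apply_ite (π i)]
  · intro s x y _ hy
    rcases Nat.eq_zero_or_pos s with rfl | hs
    · rw [pow_zero, ← hμ1]
      exact Finset.sum_le_sum_of_subset_of_nonneg (Finset.subset_univ _) fun f _ _ => hμ0 f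
    rw [hμsum, div_le_iff₀ hGpos]
    have h := sum_glueEmb_prescribed_le hn1 L hK G ν (fun π hπ => (hν π hπ).1)
      (fun π hπ J b => by convert (hν π hπ).2.2.2 J b) x y hy
    calc _ ≤ 2 * (Real.exp 1 * K / n) ^ s * (n.factorial : ℝ) ^ k := by
          refine le_trans (le_of_eq ?_) h
          refine Finset.sum_congr rfl fun π _ => Finset.sum_congr ?_ fun _ _ => rfl
          ext σ
          simp
      _ ≤ 2 * (Real.exp 1 * K / n) ^ s * (2 * G.card) := by gcongr
      _ = 4 * (Real.exp 1 * K / n) ^ s * G.card := by ring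
      _ ≤ 4 ^ s * (Real.exp 1 * K / n) ^ s * G.card := by
          gcongr
          exact le_self_pow₀ (by norm_num) hs.ne'
      _ = _ := by rw [← mul_pow, mul_div_assoc 4]
end

section
/- For every ε > 0 there exists C = C(ε) > 0 such that the following holds for every sufficiently large n. Let G = (V_1, V_2) be a balanced bipartite graph with |V_1| = |V_2| = n. If δ_{1}(G) + δ_{2}(G) ≥ (1 + ε)n, then there is a (C/n)-vertex-spread probability distribution on embeddings of perfect matchings into G (i.e., on embeddings into G of the graph consisting of n pairwise disjoint edges). -/
/-- Adjacency of the bipartite graph on `Fin n ⊕ Fin n` whose cross edges are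
given by the relation `Adj` between the two sides. -/
def bipAdj {n : ℕ} (Adj : Fin n → Fin n → Prop) : (Fin n ⊕ Fin n) → (Fin n ⊕ Fin n) → Prop
  | .inl a, .inr b => Adj a b
  | .inr b, .inl a => Adj a b
  | _, _ => False

/-- `f` is an embedding into the bipartite graph given by `Adj` of the graph consisting of
`n` pairwise disjoint edges (a perfect matching). -/
def IsPMEmbedding {n : ℕ} (Adj : Fin n → Fin n → Prop)
    (f : (Fin n ⊕ Fin n) → (Fin n ⊕ Fin n)) : Prop :=
  Function.Injective f ∧ ∀ i : Fin n, bipAdj Adj (f (Sum.inl i)) (f (Sum.inr i))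

open Finset in
/-- In a product of finite sets, prescribing membership in sets of relative density at most `q`
at `card κ` distinct coordinates leaves a proportion of at most `q ^ card κ`. -/
theorem card_piFinset_filter_le {ι κ β : Type*} [Fintype ι] [DecidableEq ι] [Fintype κ]
    [DecidableEq β] [Fintype β] (N : ι → Finset β) (x : κ → ι) (hx : Function.Injective x)
    (A : κ → Finset β) (q : ℝ)
    (h : ∀ k, (#(N (x k) ∩ A k) : ℝ) ≤ q * #(N (x k))) :
    (#{ω ∈ Fintype.piFinset N | ∀ k, ω (x k) ∈ A k} : ℝ) ≤
      q ^ Fintype.card κ * #(Fintype.piFinset N) := by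
  classical
  set B : ι → Finset β := Function.extend x A (fun _ => univ) with hB
  have hBx : ∀ k, B (x k) = A k := fun k => hx.extend_apply _ _ _
  have hsub : ({ω ∈ Fintype.piFinset N | ∀ k, ω (x k) ∈ A k} : Finset (ι → β)) ⊆
      Fintype.piFinset (fun y => N y ∩ B y) := by
    intro ω hω
    simp only [mem_filter, Fintype.mem_piFinset] at hω
    simp only [Fintype.mem_piFinset, mem_inter]
    refine fun y => ⟨hω.1 y, ?_⟩
    by_cases hy : ∃ k, x k = y
    · obtain ⟨k, rfl⟩ := hy
      rw [hBx]
      exact hω.2 k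
    · rw [hB, Function.extend_apply' _ _ _ hy]
      exact mem_univ _
  have hcard : ((univ.image x).card) = Fintype.card κ := by
    rw [card_image_of_injective _ hx, card_univ]
  calc (#{ω ∈ Fintype.piFinset N | ∀ k, ω (x k) ∈ A k} : ℝ)
      ≤ #(Fintype.piFinset (fun y => N y ∩ B y)) := by exact_mod_cast card_le_card hsub
    _ = ∏ y, (#(N y ∩ B y) : ℝ) := by rw [Fintype.card_piFinset]; push_cast; rfl
    _ ≤ ∏ y, (if y ∈ univ.image x then q else 1) * (#(N y) : ℝ) := by
        refine prod_le_prod (fun _ _ => by positivity) fun y _ => ?_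
        split_ifs with hy
        · obtain ⟨k, -, rfl⟩ := mem_image.1 hy
          rw [hBx]
          exact h k
        · rw [one_mul]
          exact_mod_cast card_le_card inter_subset_left
    _ = q ^ Fintype.card κ * #(Fintype.piFinset N) := by
        rw [prod_mul_distrib, prod_ite_mem, univ_inter, prod_const, hcard,
          Fintype.card_piFinset]
        push_cast
        rfl

/-- `n.choose r * (s / n) ^ r ≤ exp s`. -/
theorem choose_mul_div_pow_le_exp (n r s : ℕ) (hn : 0 < n) :
    (n.choose r : ℝ) * ((s : ℝ) / n) ^ r ≤ Real.exp s := by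
  have hn' : (0 : ℝ) < n := by exact_mod_cast hn
  have h1 : (n.choose r : ℝ) ≤ (n : ℝ) ^ r / (r.factorial : ℝ) := Nat.choose_le_pow_div r n
  calc (n.choose r : ℝ) * ((s : ℝ) / n) ^ r
      ≤ (n : ℝ) ^ r / (r.factorial : ℝ) * ((s : ℝ) / n) ^ r := by gcongr
    _ = (s : ℝ) ^ r / (r.factorial : ℝ) := by
        rw [div_pow]
        field_simp
    _ ≤ Real.exp s := Real.pow_div_factorial_le_exp _ (by positivity) _

/-- `(n - m)! / n! ≤ (e / n) ^ m`, with denominators cleared. -/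
theorem pow_mul_factorial_sub_le (n m : ℕ) (hm : m ≤ n) :
    (n : ℝ) ^ m * ((n - m).factorial : ℝ) ≤ Real.exp 1 ^ m * (n.factorial : ℝ) := by
  have hfac : n.factorial = (n - m).factorial * n.descFactorial m :=
    (Nat.factorial_mul_descFactorial hm).symm
  have h1 : n ^ m * m.factorial ≤ n.descFactorial m * m ^ m := by
    rw [← Nat.descFactorial_self m, Nat.descFactorial_eq_prod_range,
      Nat.descFactorial_eq_prod_range]
    have e1 : n ^ m = ∏ _i ∈ Finset.range m, n := by simp
    have e2 : m ^ m = ∏ _i ∈ Finset.range m, m := by simp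
    rw [e1, e2, ← Finset.prod_mul_distrib, ← Finset.prod_mul_distrib]
    refine Finset.prod_le_prod' fun i _ => ?_
    rw [Nat.mul_sub, Nat.sub_mul]
    have : i * m ≤ n * i := by
      rw [mul_comm n i]
      exact Nat.mul_le_mul_left i hm
    omega
  have h2 : (m : ℝ) ^ m ≤ Real.exp 1 ^ m * m.factorial := by
    have := Real.pow_div_factorial_le_exp (m : ℝ) (by positivity) m
    rw [div_le_iff₀ (by positivity)] at this
    rwa [← Real.exp_nat_mul, mul_one]
  have h1' : (n : ℝ) ^ m * m.factorial ≤ n.descFactorial m * (m : ℝ) ^ m := by exact_mod_cast h1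
  have h3 : (n : ℝ) ^ m ≤ n.descFactorial m * Real.exp 1 ^ m := by
    have hp : (0 : ℝ) < m.factorial := by positivity
    refine le_of_mul_le_mul_right (h1'.trans ?_) hp
    rw [mul_assoc]
    gcongr
  rw [hfac]
  push_cast
  calc (n : ℝ) ^ m * ((n - m).factorial : ℝ)
      ≤ n.descFactorial m * Real.exp 1 ^ m * ((n - m).factorial : ℝ) := by gcongr
    _ = _ := by ring

open Finset in
/-- The number of permutations with prescribed values on a set `D`. -/
theorem card_perm_eqOn_le {α : Type*} [Fintype α] [DecidableEq α] (D : Finset α) (v : α → α) :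
    #{σ : Equiv.Perm α | ∀ i ∈ D, σ i = v i} ≤ (Fintype.card α - #D).factorial := by
  classical
  rcases ({σ : Equiv.Perm α | ∀ i ∈ D, σ i = v i} : Finset _).eq_empty_or_nonempty with h | h
  · rw [h]
    simp
  · obtain ⟨τ, hτ⟩ := h
    simp only [mem_filter, mem_univ, true_and] at hτ
    have hc : Fintype.card {f : Equiv.Perm α // ∀ a, ¬ (a ∉ D) → f a = a} =
        (Fintype.card α - #D).factorial := by
      rw [← Fintype.card_congr (Equiv.Perm.subtypeEquivSubtypePerm (fun a => a ∉ D)),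
        Fintype.card_perm]
      simp [Fintype.card_subtype_compl]
    rw [← hc, Fintype.card_subtype]
    refine card_le_card_of_injOn (fun σ => τ⁻¹ * σ) ?_ ?_
    · intro σ hσ
      simp only [coe_filter, mem_univ, true_and, Set.mem_ofPred_eq, not_not] at hσ ⊢
      intro a ha
      simp [hσ a ha, ← hτ a ha]
    · intro σ _ σ' _ h
      exact mul_left_cancel h

open Finset in
/-- A union bound: with `L + 2` random choices from each of the sets `N (e a)`, it is unlikely
that some set `S` chooses only elements of a set `U` that is smaller than `S`, provided `U` is
quantitatively smaller than the sets `N (e a)`. -/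
theorem card_filter_deficient_le {n L : ℕ} (hn : 0 < n) {ι : Type*} [Fintype ι] [DecidableEq ι]
    (e : Fin n → ι) (he : Function.Injective e) (N : ι → Finset (Fin n)) (ε δ : ℝ) (hε : 0 < ε)
    (hδ : ε * n ≤ δ) (hN : ∀ a, δ ≤ #(N (e a)))
    (hL : Real.exp 1 ^ 2 * (1 / ε) ^ 2 * (1 / (1 + ε / 2)) ^ L ≤ 1 / 8) :
    (#{ω ∈ Fintype.piFinset (fun z : ι × Fin (L + 2) => N z.1) |
      ∃ S U : Finset (Fin n), #S = #U + 1 ∧ #U + ε * n / 2 ≤ δ ∧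
        ∀ a ∈ S, ∀ j, ω (e a, j) ∈ U} : ℝ) ≤
      1 / 4 * #(Fintype.piFinset (fun z : ι × Fin (L + 2) => N z.1)) := by
  classical
  set Ω := Fintype.piFinset (fun z : ι × Fin (L + 2) => N z.1) with hΩ
  have hn' : (0 : ℝ) < n := by exact_mod_cast hn
  set ρ : ℝ := 1 / (1 + ε / 2) with hρ
  have hρ0 : 0 < ρ := by positivity
  set P : Finset (Finset (Fin n) × Finset (Fin n)) :=
    univ.filter (fun p => #p.1 = #p.2 + 1 ∧ #p.2 + ε * n / 2 ≤ δ) with hP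
  have hsub : ({ω ∈ Ω | ∃ S U : Finset (Fin n), #S = #U + 1 ∧ #U + ε * n / 2 ≤ δ ∧
      ∀ a ∈ S, ∀ j, ω (e a, j) ∈ U} : Finset _) ⊆
      P.biUnion (fun p => {ω ∈ Ω | ∀ k : p.1 × Fin (L + 2), ω (e k.1, k.2) ∈ p.2}) := by
    intro ω hω
    obtain ⟨h0, S, U, h1, h2, h3⟩ := mem_filter.1 hω
    refine mem_biUnion.2 ⟨(S, U), by simp [hP, h1, h2], mem_filter.2 ⟨h0, fun k => ?_⟩⟩
    exact h3 _ k.1.2 _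
  set w : ℕ → ℝ := fun u => ((u : ℝ) / n) ^ 2 * ((1 / ε) ^ 2 * ρ ^ L) with hw
  have hterm : ∀ p ∈ P,
      (#{ω ∈ Ω | ∀ k : p.1 × Fin (L + 2), ω (e k.1, k.2) ∈ p.2} : ℝ) ≤
        w #p.2 ^ (#p.2 + 1) * #Ω := by
    rintro ⟨S, U⟩ hp
    simp only [hP, mem_filter, mem_univ, true_and] at hp
    obtain ⟨hS, hU⟩ := hp
    have hUn : (#U : ℝ) ≤ n := by
      exact_mod_cast (card_le_univ U).trans_eq (Fintype.card_fin n)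
    set q : ℝ := min ((#U : ℝ) / (ε * n)) ρ with hq
    have hq0 : 0 ≤ q := le_min (by positivity) hρ0.le
    have key := card_piFinset_filter_le (fun z : ι × Fin (L + 2) => N z.1)
      (fun k : S × Fin (L + 2) => (e k.1, k.2))
      (by
        rintro ⟨⟨a, ha⟩, j⟩ ⟨⟨b, hb⟩, j'⟩ h
        simp only [Prod.mk.injEq] at h
        obtain ⟨h1, rfl⟩ := h
        have := he h1
        subst this
        rfl)
      (fun _ => U) q
      (by
        intro k
        have hd : δ ≤ #(N (e k.1)) := hN _
        have hd0 : (0 : ℝ) < #(N (e k.1)) := lt_of_lt_of_le (by positivity) (hδ.trans hd)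
        have hc : (#(N (e k.1) ∩ U) : ℝ) ≤ #U := by exact_mod_cast card_le_card inter_subset_right
        rw [← div_le_iff₀ hd0]
        refine le_min ?_ ?_
        · exact div_le_div₀ (by positivity) hc (by positivity) (hδ.trans hd)
        · rw [div_le_iff₀ hd0, hρ, div_mul_eq_mul_div, one_mul, le_div_iff₀ (by positivity)]
          nlinarith)
    refine key.trans ?_
    rw [← hΩ]
    gcongr
    rw [Fintype.card_prod, Fintype.card_coe, Fintype.card_fin, mul_comm, pow_mul, hS]
    refine pow_le_pow_left₀ (by positivity) ?_ _
    calc q ^ (L + 2) = q ^ 2 * q ^ L := by ring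
      _ ≤ ((#U : ℝ) / (ε * n)) ^ 2 * ρ ^ L := by
          gcongr
          · exact min_le_left _ _
          · exact min_le_right _ _
      _ = w #U := by
          simp only [hw]
          field_simp
  have hsum : ∑ p ∈ P, w #p.2 ^ (#p.2 + 1) ≤ 1 / 4 := by
    have hmaps : ∀ p ∈ P, #p.2 ∈ range n := by
      rintro ⟨S, U⟩ hp
      simp only [hP, mem_filter, mem_univ, true_and] at hp
      have := (card_le_univ S).trans_eq (Fintype.card_fin n)
      simp only [mem_range]
      omega
    rw [← sum_fiberwise_of_maps_to hmaps]
    have hfib : ∀ u ∈ range n, ∑ p ∈ P with #p.2 = u, w #p.2 ^ (#p.2 + 1) ≤ (1 / 8) ^ (u + 1) := by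
      intro u hu
      have hun : u + 1 ≤ n := mem_range.1 hu
      have hcard : #{p ∈ P | #p.2 = u} ≤ n.choose (u + 1) * n.choose u := by
        have : ({p ∈ P | #p.2 = u} : Finset _) ⊆
            (powersetCard (u + 1) univ) ×ˢ (powersetCard u univ) := by
          rintro ⟨S, U⟩ hp
          simp only [hP, mem_filter, mem_univ, true_and] at hp
          simp only [mem_product, mem_powersetCard, subset_univ, true_and]
          omega
        refine (card_le_card this).trans_eq ?_
        simp [card_product]
      have hcard' : (#{p ∈ P | #p.2 = u} : ℝ) ≤ n.choose (u + 1) * n.choose u := by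
        exact_mod_cast hcard
      set y : ℝ := ((u + 1 : ℕ) : ℝ) / n with hy
      have hy0 : 0 ≤ y := by positivity
      have hy1 : y ≤ 1 := by
        rw [hy, div_le_one hn']
        exact_mod_cast hun
      have huy : (u : ℝ) / n ≤ y := by
        rw [hy]
        gcongr
        simp
      have c1 := choose_mul_div_pow_le_exp n (u + 1) (u + 1) hn
      have c2 := choose_mul_div_pow_le_exp n u (u + 1) hn
      rw [← hy] at c1 c2
      have c2' : (n.choose u : ℝ) * y ^ (u + 1) ≤ Real.exp ((u + 1 : ℕ) : ℝ) := by
        refine le_trans ?_ c2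
        gcongr ?_ * ?_
        exact pow_le_pow_of_le_one hy0 hy1 (Nat.le_succ u)
      have hexp : Real.exp ((u + 1 : ℕ) : ℝ) = Real.exp 1 ^ (u + 1) := by
        rw [← Real.exp_nat_mul, mul_one]
      calc ∑ p ∈ P with #p.2 = u, w #p.2 ^ (#p.2 + 1)
          = ∑ p ∈ P with #p.2 = u, w u ^ (u + 1) :=
            sum_congr rfl fun p hp => by rw [(mem_filter.1 hp).2]
        _ = #{p ∈ P | #p.2 = u} * w u ^ (u + 1) := by rw [sum_const, nsmul_eq_mul]
        _ ≤ (n.choose (u + 1) * n.choose u) * (y ^ 2 * ((1 / ε) ^ 2 * ρ ^ L)) ^ (u + 1) := by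
            simp only [hw]
            gcongr
        _ = (n.choose (u + 1) * y ^ (u + 1)) * (n.choose u * y ^ (u + 1)) *
              ((1 / ε) ^ 2 * ρ ^ L) ^ (u + 1) := by
            rw [mul_pow (y ^ 2)]
            ring
        _ ≤ Real.exp 1 ^ (u + 1) * Real.exp 1 ^ (u + 1) * ((1 / ε) ^ 2 * ρ ^ L) ^ (u + 1) := by
            rw [← hexp]
            gcongr
        _ = (Real.exp 1 ^ 2 * (1 / ε) ^ 2 * ρ ^ L) ^ (u + 1) := by
            rw [← mul_pow, ← mul_pow]
            ring
        _ ≤ (1 / 8) ^ (u + 1) := by gcongr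
    refine (sum_le_sum hfib).trans ?_
    have hg : ∑ u ∈ range n, ((1 : ℝ) / 8) ^ u ≤ 8 / 7 := by
      rw [geom_sum_eq (by norm_num), div_le_iff_of_neg (by norm_num)]
      have : (0 : ℝ) ≤ (1 / 8) ^ n := by positivity
      linarith
    have : ∑ u ∈ range n, ((1 : ℝ) / 8) ^ (u + 1) = 1 / 8 * ∑ u ∈ range n, ((1 : ℝ) / 8) ^ u := by
      rw [mul_sum]
      exact sum_congr rfl fun u _ => by ring
    rw [this]
    linarith
  calc _ ≤ (#(P.biUnion (fun p => {ω ∈ Ω | ∀ k : p.1 × Fin (L + 2), ω (e k.1, k.2) ∈ p.2})) : ℝ) := by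
        exact_mod_cast card_le_card hsub
    _ ≤ ∑ p ∈ P, (#{ω ∈ Ω | ∀ k : p.1 × Fin (L + 2), ω (e k.1, k.2) ∈ p.2} : ℝ) := by
        exact_mod_cast card_biUnion_le
    _ ≤ ∑ p ∈ P, w #p.2 ^ (#p.2 + 1) * #Ω := sum_le_sum hterm
    _ = (∑ p ∈ P, w #p.2 ^ (#p.2 + 1)) * #Ω := by rw [sum_mul]
    _ ≤ 1 / 4 * #Ω := by gcongr

open Finset in
/-- Hall's theorem for the union of two families of random choices: if there is no perfect matching,
then one of the two families has a deficient set. -/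
theorem exists_perm_or_deficient {n K : ℕ} (ω : (Fin n ⊕ Fin n) × Fin K → Fin n) :
    (∃ π : Equiv.Perm (Fin n), ∀ a, ∃ j, ω (.inl a, j) = π a ∨ ω (.inr (π a), j) = a) ∨
    ∃ S U T W : Finset (Fin n), #S = #U + 1 ∧ #T = #W + 1 ∧ #U + #W + 1 = n ∧
      (∀ a ∈ S, ∀ j, ω (.inl a, j) ∈ U) ∧ ∀ b ∈ T, ∀ j, ω (.inr b, j) ∈ W := by
  classical
  set t : Fin n → Finset (Fin n) := fun a =>
    {b | ∃ j, ω (.inl a, j) = b ∨ ω (.inr b, j) = a} with ht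
  by_cases hall : ∀ S : Finset (Fin n), #S ≤ #(S.biUnion t)
  · left
    obtain ⟨f, hf, hft⟩ := (all_card_le_biUnion_card_iff_exists_injective t).1 hall
    refine ⟨Equiv.ofBijective f (Finite.injective_iff_bijective.1 hf), fun a => ?_⟩
    simpa [ht] using hft a
  · right
    push Not at hall
    obtain ⟨S, hS⟩ := hall
    have hSn : #S ≤ n := (card_le_univ S).trans_eq (Fintype.card_fin n)
    obtain ⟨U, hU, hUc⟩ := exists_superset_card_eq (n := #S - 1) (s := S.biUnion t) (by omega)
      (by rw [Fintype.card_fin]; omega)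
    have hSc : #Sᶜ = n - #S := by rw [card_compl, Fintype.card_fin]
    have hUc' : #Uᶜ = n - #U := by rw [card_compl, Fintype.card_fin]
    refine ⟨S, U, Uᶜ, Sᶜ, by omega, by omega, by omega, fun a ha j => hU ?_, fun b hb j => ?_⟩
    · exact mem_biUnion.2 ⟨a, ha, by
        simp only [ht, mem_filter, mem_univ, true_and]
        exact ⟨j, .inl rfl⟩⟩
    · rw [mem_compl] at hb ⊢
      exact fun hmem => hb (hU (mem_biUnion.2 ⟨_, hmem, by
        simp only [ht, mem_filter, mem_univ, true_and]; exact ⟨j, .inr rfl⟩⟩))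

open Finset in
open Classical in
/-- A spread distribution on perfect matchings, given as the image of the uniform distribution
on a finite type under `M`. -/
theorem exists_spread_perm_family {n L : ℕ} (hn : 0 < n) (ε : ℝ) (hε : 0 < ε)
    (hL : Real.exp 1 ^ 2 * (1 / ε) ^ 2 * (1 / (1 + ε / 2)) ^ L ≤ 1 / 8)
    (Adj : Fin n → Fin n → Prop)
    (hdeg : ∀ a b : Fin n, (1 + ε) * n ≤ (#{b' | Adj a b'} : ℝ) + (#{a' | Adj a' b} : ℝ)) :
    ∃ (β : Type) (_ : Fintype β) (M : β → Equiv.Perm (Fin n)), Nonempty β ∧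
      (∀ ω a, Adj a (M ω a)) ∧ ∀ (D : Finset (Fin n)) (π : Equiv.Perm (Fin n)),
        (#{ω | ∀ a ∈ D, M ω a = π a} : ℝ) ≤
          2 * (2 * (L + 2) / (ε * n)) ^ #D * Fintype.card β := by
  have hn' : (0 : ℝ) < n := by exact_mod_cast hn
  have : Nonempty (Fin n) := ⟨⟨0, hn⟩⟩
  set N : Fin n ⊕ Fin n → Finset (Fin n) :=
    Sum.elim (fun a => univ.filter fun b => Adj a b) (fun b => univ.filter fun a => Adj a b) with hN
  obtain ⟨a₀, ha₀⟩ := Finite.exists_min (fun a => #(N (.inl a)))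
  obtain ⟨b₀, hb₀⟩ := Finite.exists_min (fun b => #(N (.inr b)))
  have hsum : (1 + ε) * n ≤ (#(N (.inl a₀)) : ℝ) + #(N (.inr b₀)) := hdeg a₀ b₀
  have hle : ∀ v, (#(N v) : ℝ) ≤ n := fun v => by
    exact_mod_cast (card_le_univ _).trans_eq (Fintype.card_fin n)
  have hδ₁ : ε * n ≤ #(N (.inl a₀)) := by linarith [hle (.inr b₀)]
  have hδ₂ : ε * n ≤ #(N (.inr b₀)) := by linarith [hle (.inl a₀)]
  have hNε : ∀ v, ε * n ≤ #(N v) := by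
    rintro (a | b)
    · exact hδ₁.trans (by exact_mod_cast ha₀ a)
    · exact hδ₂.trans (by exact_mod_cast hb₀ b)
  set Ω := Fintype.piFinset (fun z : (Fin n ⊕ Fin n) × Fin (L + 2) => N z.1) with hΩ
  have hΩ0 : 0 < #Ω := by
    rw [hΩ, Fintype.card_piFinset]
    refine prod_pos fun z _ => ?_
    have : (0 : ℝ) < #(N z.1) := lt_of_lt_of_le (by positivity) (hNε z.1)
    exact_mod_cast this
  set H : ((Fin n ⊕ Fin n) × Fin (L + 2) → Fin n) → Prop := fun ω =>
    ∃ π : Equiv.Perm (Fin n), ∀ a, ∃ j, ω (.inl a, j) = π a ∨ ω (.inr (π a), j) = a with hH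
  have hbad₁ := card_filter_deficient_le (L := L) hn (Sum.inl : Fin n → Fin n ⊕ Fin n)
    Sum.inl_injective N ε _ hε hδ₁ (fun a => by exact_mod_cast ha₀ a) hL
  have hbad₂ := card_filter_deficient_le (L := L) hn (Sum.inr : Fin n → Fin n ⊕ Fin n)
    Sum.inr_injective N ε _ hε hδ₂ (fun a => by exact_mod_cast hb₀ a) hL
  rw [← hΩ] at hbad₁ hbad₂
  have hbad : (#{ω ∈ Ω | ¬ H ω} : ℝ) ≤ 1 / 2 * #Ω := by
    refine le_trans ?_ ((add_le_add hbad₁ hbad₂).trans_eq (by ring))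
    rw [← Nat.cast_add, Nat.cast_le]
    refine le_trans (card_le_card fun ω hω => ?_) (card_union_le _ _)
    obtain ⟨hω, hnot⟩ := mem_filter.1 hω
    obtain ⟨S, U, T, W, h1, h2, h3, h4, h5⟩ := (exists_perm_or_deficient ω).resolve_left hnot
    have h3' : (#U : ℝ) + #W + 1 = n := by exact_mod_cast h3
    rcases le_total ((#U : ℝ) + ε * n / 2) #(N (.inl a₀)) with h | h
    · exact mem_union_left _ (mem_filter.2 ⟨hω, S, U, h1, h, h4⟩)
    · exact mem_union_right _ (mem_filter.2 ⟨hω, T, W, h2, by linarith, h5⟩)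
  have hgood : (#Ω : ℝ) ≤ 2 * #{ω ∈ Ω | H ω} := by
    have : (#{ω ∈ Ω | H ω} : ℝ) + #{ω ∈ Ω | ¬ H ω} = #Ω := by
      exact_mod_cast card_filter_add_card_filter_not (s := Ω) H
    linarith
  have hβ : (Fintype.card ↥({ω ∈ Ω | H ω} : Finset _) : ℝ) = #{ω ∈ Ω | H ω} := by
    rw [Fintype.card_coe]
  have hΩ0' : (0 : ℝ) < #Ω := by exact_mod_cast hΩ0
  choose M hM using fun ω : ↥({ω ∈ Ω | H ω} : Finset _) => (mem_filter.1 ω.2).2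
  refine ⟨_, inferInstance, M, ?_, ?_, ?_⟩
  · rw [← Fintype.card_pos_iff]
    have : (0 : ℝ) < Fintype.card ↥({ω ∈ Ω | H ω} : Finset _) := by rw [hβ]; linarith
    exact_mod_cast this
  · intro ω a
    have hmem := Fintype.mem_piFinset.1 (mem_filter.1 ω.2).1
    obtain ⟨j, hj | hj⟩ := hM ω a
    · have := hmem (.inl a, j)
      rw [hj] at this
      simpa [hN] using this
    · have := hmem (.inr (M ω a), j)
      rw [hj] at this
      simpa [hN] using this
  · intro D π
    set x : (D → Bool × Fin (L + 2)) → D → (Fin n ⊕ Fin n) × Fin (L + 2) := fun c k =>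
      (if (c k).1 then .inl k.1 else .inr (π k), (c k).2) with hx
    set v : (D → Bool × Fin (L + 2)) → D → Fin n := fun c k =>
      if (c k).1 then π k else k with hv
    have hxinj : ∀ c, Function.Injective (x c) := by
      intro c k k' h
      simp only [hx, Prod.mk.injEq] at h
      have h1 := h.1
      split_ifs at h1
      · exact Subtype.ext (Sum.inl_injective h1)
      · exact Subtype.ext (π.injective (Sum.inr_injective h1))
    have hcount : ∀ c, (#{ω ∈ Ω | ∀ k, ω (x c k) ∈ ({v c k} : Finset _)} : ℝ) ≤
        (1 / (ε * n)) ^ #D * #Ω := by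
      intro c
      have := card_piFinset_filter_le (fun z : (Fin n ⊕ Fin n) × Fin (L + 2) => N z.1) (x c)
        (hxinj c) (fun k => {v c k}) (1 / (ε * n)) (by
          intro k
          refine le_trans (b := 1) ?_ ?_
          · exact_mod_cast (card_le_card inter_subset_right).trans_eq (card_singleton _)
          · rw [div_mul_eq_mul_div, one_mul, le_div_iff₀ (by positivity), one_mul]
            exact hNε _)
      rwa [Fintype.card_coe] at this
    have hsub : #{ω | ∀ a ∈ D, M ω a = π a} ≤
        #(univ.biUnion fun c => {ω ∈ Ω | ∀ k, ω (x c k) ∈ ({v c k} : Finset _)}) := by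
      refine card_le_card_of_injOn Subtype.val ?_ Subtype.val_injective.injOn
      intro ω hω
      simp only [coe_filter, mem_univ, true_and, Set.mem_ofPred_eq] at hω
      have : ∀ k : D, ∃ c : Bool × Fin (L + 2),
          ω.1 (if c.1 then .inl k.1 else .inr (π k), c.2) = if c.1 then π k else k := by
        intro k
        obtain ⟨j, hj⟩ := hM ω k
        rw [hω k k.2] at hj
        rcases hj with hj | hj
        · exact ⟨(true, j), by simpa using hj⟩
        · exact ⟨(false, j), by simpa using hj⟩
      choose c hc using this
      refine mem_coe.2 (mem_biUnion.2 ⟨c, mem_univ _, mem_filter.2 ⟨(mem_filter.1 ω.2).1, ?_⟩⟩)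
      exact fun k => mem_singleton.2 (hc k)
    calc (#{ω | ∀ a ∈ D, M ω a = π a} : ℝ)
        ≤ ∑ c, (#{ω ∈ Ω | ∀ k, ω (x c k) ∈ ({v c k} : Finset _)} : ℝ) := by
          exact_mod_cast hsub.trans card_biUnion_le
      _ ≤ ∑ _c : D → Bool × Fin (L + 2), (1 / (ε * n)) ^ #D * (#Ω : ℝ) :=
          sum_le_sum fun c _ => hcount c
      _ = (2 * (L + 2) / (ε * n)) ^ #D * (#Ω : ℝ) := by
          rw [sum_const, card_univ, Fintype.card_fun, Fintype.card_prod, Fintype.card_bool,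
            Fintype.card_fin, Fintype.card_coe, nsmul_eq_mul, ← mul_assoc]
          push_cast
          rw [← mul_pow, mul_one_div]
      _ ≤ (2 * (L + 2) / (ε * n)) ^ #D * (2 * #{ω ∈ Ω | H ω}) := by gcongr
      _ = _ := by rw [hβ]; ring

open Finset in
/-- The push-forward of a uniform distribution, as an explicit weight function. -/
theorem sum_filter_card_fiber {γ δ : Type*} [Fintype γ] [Fintype δ] [DecidableEq δ] (Φ : γ → δ)
    (p : δ → Prop) [DecidablePred p] :
    ∑ f ∈ univ.filter p, (#{z | Φ z = f} : ℝ) / Fintype.card γ =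
      #{z | p (Φ z)} / Fintype.card γ := by
  classical
  rw [← sum_div]
  congr 1
  have h := card_eq_sum_card_fiberwise (f := Φ) (s := {z | p (Φ z)}) (t := univ.filter p)
    (fun z hz => by simpa using hz)
  rw [h]
  push_cast
  refine sum_congr rfl fun f hf => ?_
  congr 2
  ext z
  simp only [mem_filter, mem_univ, true_and]
  constructor
  · rintro rfl
    exact ⟨(mem_filter.1 hf).2, rfl⟩
  · exact fun h => h.2

open Classical in
theorem vertex_spread_PM_bipartite_degreeSum (ε : ℝ) (hε : 0 < ε) :
    ∃ C : ℝ, 0 < C ∧ ∃ n₀ : ℕ, ∀ n : ℕ, n₀ ≤ n →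
    ∀ Adj : Fin n → Fin n → Prop,
      (∀ a b : Fin n,
        (1 + ε) * n ≤ ((Finset.univ.filter fun b' => Adj a b').card : ℝ) +
          ((Finset.univ.filter fun a' => Adj a' b).card : ℝ)) →
      ∃ μ : ((Fin n ⊕ Fin n) → (Fin n ⊕ Fin n)) → ℝ,
        (∀ f, 0 ≤ μ f) ∧ (∑ f, μ f = 1) ∧
        (∀ f, μ f ≠ 0 → IsPMEmbedding Adj f) ∧
        IsVertexSpread (C / n) μ := by
  classical
  obtain ⟨L, hL⟩ : ∃ L : ℕ,
      Real.exp 1 ^ 2 * (1 / ε) ^ 2 * (1 / (1 + ε / 2)) ^ L ≤ 1 / 8 := by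
    have hlim : Filter.Tendsto
        (fun L : ℕ => Real.exp 1 ^ 2 * (1 / ε) ^ 2 * (1 / (1 + ε / 2)) ^ L)
        Filter.atTop (nhds (Real.exp 1 ^ 2 * (1 / ε) ^ 2 * 0)) := by
      refine Filter.Tendsto.const_mul _ (tendsto_pow_atTop_nhds_zero_of_lt_one (by positivity) ?_)
      rw [div_lt_one (by positivity)]
      linarith
    rw [mul_zero] at hlim
    exact (hlim.eventually_le_const (by norm_num)).exists
  set c₁ : ℝ := 2 * (L + 2) / ε with hc₁
  have hc₁0 : 0 < c₁ := by positivity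
  refine ⟨2 * (c₁ + Real.exp 1), by positivity, 1, fun n hn Adj hdeg => ?_⟩
  have hn' : (0 : ℝ) < n := by exact_mod_cast hn
  obtain ⟨β, _, M, hβ, hAdj, hM⟩ := exists_spread_perm_family hn ε hε hL Adj hdeg
  set Φ : β × Equiv.Perm (Fin n) → (Fin n ⊕ Fin n) → (Fin n ⊕ Fin n) := fun z =>
    Sum.map z.2 (fun i => M z.1 (z.2 i)) with hΦ
  have hcardpos : (0 : ℝ) < Fintype.card (β × Equiv.Perm (Fin n)) := by
    exact_mod_cast Fintype.card_pos
  refine ⟨fun f => (Finset.card {z | Φ z = f} : ℝ) / Fintype.card (β × Equiv.Perm (Fin n)),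
    fun f => by positivity, ?_, ?_, ?_⟩
  · have := sum_filter_card_fiber Φ (fun _ => True)
    simp only [Finset.filter_true] at this
    rw [this, Finset.card_univ, div_self hcardpos.ne']
  · intro f hf
    have hne : (Finset.card {z | Φ z = f}) ≠ 0 := by
      intro h
      simp [h] at hf
    obtain ⟨z, hz⟩ := Finset.card_pos.1 (Nat.pos_of_ne_zero hne)
    obtain rfl : Φ z = f := (Finset.mem_filter.1 hz).2
    exact ⟨z.2.injective.sumMap ((M z.1).injective.comp z.2.injective), fun i => hAdj _ _⟩
  · intro s x y hx _
    have hsum := sum_filter_card_fiber Φ (fun f => ∀ i, f (x i) = y i)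
    refine le_trans (le_of_eq (by convert hsum)) ?_
    rw [div_le_iff₀ hcardpos]
    set X : Finset (β × Equiv.Perm (Fin n)) := {z | ∀ i, Φ z (x i) = y i} with hX
    rcases X.eq_empty_or_nonempty with hemp | ⟨⟨ω₀, σ₀⟩, hz₀⟩
    · rw [hemp, Finset.card_empty, Nat.cast_zero]
      positivity
    have hz₀' : ∀ i, Φ (ω₀, σ₀) (x i) = y i := (Finset.mem_filter.1 hz₀).2
    set A : Finset (Fin n) := {i | Sum.inl i ∈ Finset.univ.image x} with hA
    set B : Finset (Fin n) := {i | Sum.inr i ∈ Finset.univ.image x} with hB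
    have hs : A.card + B.card = s := by
      have h1 : A.disjSum B = Finset.univ.image x := by
        ext (i | i) <;> simp [hA, hB]
      rw [← Finset.card_disjSum, h1, Finset.card_image_of_injective _ hx, Finset.card_univ,
        Fintype.card_fin]
    have hσA : ∀ z ∈ X, ∀ i ∈ A, z.2 i = σ₀ i := by
      intro z hz i hi
      obtain ⟨p, -, hp⟩ := Finset.mem_image.1 (Finset.mem_filter.1 hi).2
      have h := ((Finset.mem_filter.1 hz).2 p).trans (hz₀' p).symm
      rw [hp] at h
      exact Sum.inl_injective h
    have hMB : ∀ z ∈ X, ∀ i ∈ B, M z.1 (z.2 i) = M ω₀ (σ₀ i) := by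
      intro z hz i hi
      obtain ⟨p, -, hp⟩ := Finset.mem_image.1 (Finset.mem_filter.1 hi).2
      have h := ((Finset.mem_filter.1 hz).2 p).trans (hz₀' p).symm
      rw [hp] at h
      exact Sum.inr_injective h
    set D : Finset (Fin n) := (A ∩ B).image σ₀ with hD
    have hDc : D.card = (A ∩ B).card := Finset.card_image_of_injective _ σ₀.injective
    set G : Finset β := {ω | ∀ a ∈ D, M ω a = M ω₀ a} with hG
    have hsub : X ⊆ G.biUnion fun ω =>
        ({ω} : Finset β) ×ˢ ({σ | ∀ i ∈ A ∪ B, σ i =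
          if i ∈ A then σ₀ i else (M ω).symm (M ω₀ (σ₀ i))} : Finset (Equiv.Perm (Fin n))) := by
      rintro ⟨ω, σ⟩ hz
      refine Finset.mem_biUnion.2 ⟨ω, ?_, ?_⟩
      · refine Finset.mem_filter.2 ⟨Finset.mem_univ _, fun a ha => ?_⟩
        obtain ⟨i, hi, rfl⟩ := Finset.mem_image.1 ha
        obtain ⟨hiA, hiB⟩ := Finset.mem_inter.1 hi
        have h1 := hσA _ hz i hiA
        have h2 := hMB _ hz i hiB
        rwa [h1] at h2
      · refine Finset.mem_product.2 ⟨Finset.mem_singleton_self _,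
          Finset.mem_filter.2 ⟨Finset.mem_univ _, fun i hi => ?_⟩⟩
        split_ifs with hiA
        · exact hσA _ hz i hiA
        · have hiB := (Finset.mem_union.1 hi).resolve_left hiA
          rw [Equiv.eq_symm_apply]
          exact hMB _ hz i hiB
    set k := (A ∩ B).card with hk
    set m := (A ∪ B).card with hm
    have hkm : m + k = s := by rw [hm, hk, Finset.card_union_add_card_inter, hs]
    have hmn : m ≤ n := (Finset.card_le_univ _).trans_eq (Fintype.card_fin n)
    have hXc : X.card ≤ G.card * (n - m).factorial := by
      refine (Finset.card_le_card hsub).trans (Finset.card_biUnion_le_card_mul _ _ _ fun ω _ => ?_)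
      rw [Finset.card_product, Finset.card_singleton, one_mul]
      have := card_perm_eqOn_le (A ∪ B)
        (fun i => if i ∈ A then σ₀ i else (M ω).symm (M ω₀ (σ₀ i)))
      rw [Fintype.card_fin] at this
      convert this
    rcases Nat.eq_zero_or_pos s with rfl | hspos
    · rw [pow_zero, one_mul]
      exact_mod_cast Finset.card_le_univ X
    have hGc : (G.card : ℝ) ≤ 2 * (c₁ / n) ^ k * Fintype.card β := by
      have h := hM D (M ω₀)
      rwa [hDc, ← div_div] at h
    have hfac : ((n - m).factorial : ℝ) ≤ (Real.exp 1 / n) ^ m * n.factorial := by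
      rw [div_pow, div_mul_eq_mul_div, le_div_iff₀ (by positivity), mul_comm]
      exact pow_mul_factorial_sub_le n m hmn
    have hC0 : 0 ≤ (c₁ + Real.exp 1) / n := by positivity
    calc (X.card : ℝ) ≤ G.card * (n - m).factorial := by exact_mod_cast hXc
      _ ≤ (2 * (c₁ / n) ^ k * Fintype.card β) * ((Real.exp 1 / n) ^ m * n.factorial) := by gcongr
      _ ≤ (2 * ((c₁ + Real.exp 1) / n) ^ k * Fintype.card β) *
            (((c₁ + Real.exp 1) / n) ^ m * n.factorial) := by
          gcongr
          · linarith [Real.exp_pos 1]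
          · linarith
      _ = 2 * ((c₁ + Real.exp 1) / n) ^ s * (Fintype.card β * n.factorial) := by
          rw [← hkm, pow_add]
          ring
      _ ≤ 2 ^ s * ((c₁ + Real.exp 1) / n) ^ s * (Fintype.card β * n.factorial) := by
          gcongr
          exact le_self_pow₀ (by norm_num) (by omega)
      _ = (2 * (c₁ + Real.exp 1) / n) ^ s * Fintype.card (β × Equiv.Perm (Fin n)) := by
          rw [← mul_pow, mul_div_assoc, Fintype.card_prod, Fintype.card_perm, Fintype.card_fin]
          push_cast
          rfl
end
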